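/- arXiv:2409.14463 — 2 statements merged into one kernel-verified Lean document; each statement's English description precedes it below -/
import Mathlib

section
/- The outward normal derivative of v_k on the unit circle converges uniformly to −8: sup_{x ∈ ∂B₁} | (∂v_k/∂ν)(x) + 8 | → 0 as k → ∞. -/
open MeasureTheory Filter Metric Set

noncomputable section

/-- Directional derivative of a function `f : ℂ → ℝ` in direction `v`. -/
def dderiv (v : ℂ) (f : ℂ → ℝ) : ℂ → ℝ := fun z => fderiv ℝ f z v

/-- Iterated partial derivative `∂ₓ^m ∂_y^n f` of `f : ℂ → ℝ`. -/
def pd (m n : ℕ) (f : ℂ → ℝ) : ℂ → ℝ := (dderiv 1)^[m] ((dderiv Complex.I)^[n] f)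

/-- Laplacian of `f : ℂ → ℝ`. -/
def lap (f : ℂ → ℝ) : ℂ → ℝ := fun z => pd 2 0 f z + pd 0 2 f z

/-- Gradient of `f : ℂ → ℝ` at `z`, viewed as a complex number. -/
def grad (f : ℂ → ℝ) (z : ℂ) : ℂ :=
  (dderiv 1 f z : ℂ) + (dderiv Complex.I f z : ℂ) * Complex.I

/-- The unit complex number of argument `θ`. -/
def cis (θ : ℝ) : ℂ := Complex.exp (θ * Complex.I)

lemma hasDerivAt_cis (θ : ℝ) : HasDerivAt cis (cis θ * Complex.I) θ := by
  have := (((Complex.ofRealCLM.hasDerivAt (x := θ)).mul_const Complex.I)).cexp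
  have h2 : (fun x : ℝ => Complex.exp (Complex.ofRealCLM x * Complex.I)) = cis := rfl
  rw [h2] at this
  convert this using 1
  simp [cis]

lemma continuous_cis : Continuous cis := by unfold cis; fun_prop

@[simp] lemma norm_cis (θ : ℝ) : ‖cis θ‖ = 1 := Complex.norm_exp_ofReal_mul_I θ

lemma cis_eq (θ : ℝ) : cis θ = ⟨Real.cos θ, Real.sin θ⟩ := by
  unfold cis; rw [Complex.exp_mul_I]; apply Complex.ext <;> simp [← Complex.ofReal_cos, ← Complex.ofReal_sin]

lemma cis_neg_pi_eq : cis (-Real.pi) = cis Real.pi := by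
  simp [cis_eq]

section calculus

variable {u : ℂ → ℝ} {U : Set ℂ}

lemma lap_eq (hU : IsOpen U) (hu : ContDiffOn ℝ 2 u U) {z : ℂ} (hz : z ∈ U) :
    lap u z = fderiv ℝ (fderiv ℝ u) z 1 1 + fderiv ℝ (fderiv ℝ u) z Complex.I Complex.I := by
  have hd : DifferentiableAt ℝ (fderiv ℝ u) z :=
    ((hu.fderiv_of_isOpen hU (m := 1) (by norm_num)).contDiffAt (hU.mem_nhds hz)).differentiableAt
      (by norm_num)
  have key (w : ℂ) : fderiv ℝ (fun y => fderiv ℝ u y w) z w = fderiv ℝ (fderiv ℝ u) z w w := by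
    rw [fderiv_clm_apply hd (by fun_prop)]; simp
  simp only [lap, pd, Function.iterate_succ, Function.iterate_zero, Function.comp, id, dderiv]
  rw [← key, ← key]
  rfl

lemma rotated_trace (B : ℂ →L[ℝ] ℂ →L[ℝ] ℝ) (θ : ℝ) :
    B (cis θ) (cis θ) + B (cis θ * Complex.I) (cis θ * Complex.I)
      = B 1 1 + B Complex.I Complex.I := by
  have h1 : cis θ = Real.cos θ • (1 : ℂ) + Real.sin θ • Complex.I := by
    rw [cis_eq]; apply Complex.ext <;> simp [-Complex.ofReal_cos, -Complex.ofReal_sin]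
  have h2 : cis θ * Complex.I = -Real.sin θ • (1 : ℂ) + Real.cos θ • Complex.I := by
    rw [cis_eq]; apply Complex.ext <;> simp [-Complex.ofReal_cos, -Complex.ofReal_sin]
  rw [h2, h1]
  simp only [map_add, map_smul, add_apply, smul_apply,
    smul_eq_mul]
  linear_combination (B 1 1 + B Complex.I Complex.I) * Real.sin_sq_add_cos_sq θ

lemma contDiffOn_fderiv (hU : IsOpen U) (hu : ContDiffOn ℝ 2 u U) :
    ContDiffOn ℝ 1 (fderiv ℝ u) U := hu.fderiv_of_isOpen hU (by norm_num)

lemma continuousOn_lap (hU : IsOpen U) (hu : ContDiffOn ℝ 2 u U) : ContinuousOn (lap u) U := by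
  have h : ContinuousOn (fderiv ℝ (fderiv ℝ u)) U :=
    (contDiffOn_fderiv hU hu).continuousOn_fderiv_of_isOpen hU le_rfl
  have : ContinuousOn (fun z => fderiv ℝ (fderiv ℝ u) z 1 1
      + fderiv ℝ (fderiv ℝ u) z Complex.I Complex.I) U := by fun_prop
  exact this.congr fun z hz => lap_eq hU hu hz

lemma hasFDerivAt_of_mem (hU : IsOpen U) (hu : ContDiffOn ℝ 2 u U) {z : ℂ} (hz : z ∈ U) :
    HasFDerivAt u (fderiv ℝ u z) z :=
  ((hu.contDiffAt (hU.mem_nhds hz)).differentiableAt (by norm_num)).hasFDerivAt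

lemma hasFDerivAt_fderiv_of_mem (hU : IsOpen U) (hu : ContDiffOn ℝ 2 u U) {z : ℂ} (hz : z ∈ U) :
    HasFDerivAt (fderiv ℝ u) (fderiv ℝ (fderiv ℝ u) z) z :=
  (((contDiffOn_fderiv hU hu).contDiffAt (hU.mem_nhds hz)).differentiableAt
    (by norm_num)).hasFDerivAt

lemma polar_mem {x : ℂ} {R r θ : ℝ} (hr0 : 0 ≤ r) (hr : r ≤ R) :
    x + r • cis θ ∈ closedBall x R := by
  simp [abs_of_nonneg hr0, hr]

lemma hasDerivAt_polar_r (x : ℂ) (r θ : ℝ) : HasDerivAt (fun s : ℝ => x + s • cis θ) (cis θ) r := by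
  simpa using ((hasDerivAt_id r).smul_const (cis θ)).const_add x

lemma hasDerivAt_polar_theta (x : ℂ) (r θ : ℝ) :
    HasDerivAt (fun t : ℝ => x + r • cis t) (r • (cis θ * Complex.I)) θ :=
  ((hasDerivAt_cis θ).const_smul r).const_add x

lemma continuous_polar (x : ℂ) : Continuous (fun p : ℝ × ℝ => x + p.1 • cis p.2) := by
  have := continuous_cis
  fun_prop

end calculus

/-- Integration of a divergence in polar coordinates over an annulus. -/
lemma green_polar {u : ℂ → ℝ} {U : Set ℂ} (hU : IsOpen U) (hu : ContDiffOn ℝ 2 u U)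
    {x : ℂ} {δ R : ℝ} (hδ : 0 < δ) (hδR : δ ≤ R) (hx : closedBall x R ⊆ U)
    {A A1 A2 c c1 c2 : ℝ → ℝ}
    (hA : ∀ r, 0 < r → HasDerivAt A (A1 r) r) (hA1 : ∀ r, 0 < r → HasDerivAt A1 (A2 r) r)
    (hA2 : ContinuousOn A2 (Ioi 0))
    (hc : ∀ θ, HasDerivAt c (c1 θ) θ) (hc1 : ∀ θ, HasDerivAt c1 (c2 θ) θ) (hc2 : Continuous c2)
    (hcp : c (-Real.pi) = c Real.pi) (hc1p : c1 (-Real.pi) = c1 Real.pi)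
    (hK : ∀ r, 0 < r → ∀ θ, (A1 r + r * A2 r) * c θ + A r / r * c2 θ = 0) :
    ∫ r in δ..R, ∫ θ in (-Real.pi)..Real.pi,
        r * (A r * c θ * lap u (x + r • cis θ)) =
      (∫ θ in (-Real.pi)..Real.pi, R * (A R * fderiv ℝ u (x + R • cis θ) (cis θ)
          - A1 R * u (x + R • cis θ)) * c θ)
      - ∫ θ in (-Real.pi)..Real.pi, δ * (A δ * fderiv ℝ u (x + δ • cis θ) (cis θ)
          - A1 δ * u (x + δ • cis θ)) * c θ := by
  set g1 := fderiv ℝ u with hg1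
  set g2 := fderiv ℝ g1 with hg2
  set Pr : ℝ → ℝ → ℝ := fun r θ => (A r * g1 (x + r • cis θ) (cis θ)
    + r * A r * g2 (x + r • cis θ) (cis θ) (cis θ)
    - (A1 r + r * A2 r) * u (x + r • cis θ)) * c θ with hPr
  set Qt : ℝ → ℝ → ℝ := fun r θ => A r * (r * g2 (x + r • cis θ) (cis θ * Complex.I)
    (cis θ * Complex.I) - g1 (x + r • cis θ) (cis θ)) * c θ
    - A r / r * u (x + r • cis θ) * c2 θ with hQt
  have hmem : ∀ r ∈ Icc δ R, ∀ θ, x + r • cis θ ∈ U := fun r hr θ =>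
    hx (polar_mem (hδ.le.trans hr.1) hr.2)
  have hpos : ∀ r ∈ Icc δ R, 0 < r := fun r hr => hδ.trans_le hr.1
  have hsplit : ∀ r ∈ Icc δ R, ∀ θ, r * (A r * c θ * lap u (x + r • cis θ)) = Pr r θ + Qt r θ := by
    intro r hr θ
    rw [lap_eq hU hu (hmem r hr θ), ← rotated_trace _ θ]
    simp only [hPr, hQt]
    linear_combination (u (x + r • cis θ)) * hK r (hpos r hr) θ
  have hP : ∀ θ, ∀ r ∈ Icc δ R, HasDerivAt (fun s : ℝ => s * (A s * g1 (x + s • cis θ) (cis θ)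
      - A1 s * u (x + s • cis θ)) * c θ) (Pr r θ) r := by
    intro θ r hr
    have h0 := hpos r hr
    have d1 : HasDerivAt (fun s : ℝ => u (x + s • cis θ)) (g1 (x + r • cis θ) (cis θ)) r :=
      (hasFDerivAt_of_mem hU hu (hmem r hr θ)).comp_hasDerivAt r (hasDerivAt_polar_r x r θ)
    have d2 : HasDerivAt (fun s : ℝ => g1 (x + s • cis θ)) (g2 (x + r • cis θ) (cis θ)) r :=
      (hasFDerivAt_fderiv_of_mem hU hu (hmem r hr θ)).comp_hasDerivAt r (hasDerivAt_polar_r x r θ)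
    have d3 : HasDerivAt (fun s : ℝ => g1 (x + s • cis θ) (cis θ))
        (g2 (x + r • cis θ) (cis θ) (cis θ)) r := by
      simpa using d2.clm_apply (hasDerivAt_const r (cis θ))
    have := ((hasDerivAt_id r).mul (((hA r h0).mul d3).sub ((hA1 r h0).mul d1))).mul_const (c θ)
    refine HasDerivAt.congr_deriv this ?_
    simp only [hPr, id, Pi.sub_apply, Pi.mul_apply]
    ring
  have hQ : ∀ r ∈ Icc δ R, ∀ θ, HasDerivAt (fun t : ℝ =>
      A r * g1 (x + r • cis t) (cis t * Complex.I) * c t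
      - A r / r * u (x + r • cis t) * c1 t) (Qt r θ) θ := by
    intro r hr θ
    have h0 := hpos r hr
    have d1 : HasDerivAt (fun s : ℝ => u (x + r • cis s))
        (g1 (x + r • cis θ) (r • (cis θ * Complex.I))) θ :=
      (hasFDerivAt_of_mem hU hu (hmem r hr θ)).comp_hasDerivAt θ (hasDerivAt_polar_theta x r θ)
    have d2 : HasDerivAt (fun s : ℝ => g1 (x + r • cis s))
        (g2 (x + r • cis θ) (r • (cis θ * Complex.I))) θ :=
      (hasFDerivAt_fderiv_of_mem hU hu (hmem r hr θ)).comp_hasDerivAt θ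
        (hasDerivAt_polar_theta x r θ)
    have d3 := d2.clm_apply ((hasDerivAt_cis θ).mul_const Complex.I)
    have := ((d3.const_mul (A r)).mul (hc θ)).sub ((d1.const_mul (A r / r)).mul (hc1 θ))
    refine HasDerivAt.congr_deriv this ?_
    have hI : cis θ * Complex.I * Complex.I = - cis θ := by
      rw [mul_assoc, Complex.I_mul_I]; ring
    simp only [hQt, hI, map_smul, smul_apply, smul_eq_mul, map_neg]
    field_simp
    ring
  have hE : ContinuousOn (fun p : ℝ × ℝ => x + p.1 • cis p.2) (Icc δ R ×ˢ univ) :=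
    (continuous_polar x).continuousOn
  have hEm : MapsTo (fun p : ℝ × ℝ => x + p.1 • cis p.2) (Icc δ R ×ˢ univ) U :=
    fun p hp => hmem _ hp.1 _
  have cu : ContinuousOn (fun p : ℝ × ℝ => u (x + p.1 • cis p.2)) (Icc δ R ×ˢ univ) :=
    hu.continuousOn.comp hE hEm
  have cg1 : ContinuousOn (fun p : ℝ × ℝ => g1 (x + p.1 • cis p.2)) (Icc δ R ×ˢ univ) :=
    (contDiffOn_fderiv hU hu).continuousOn.comp hE hEm
  have cg2 : ContinuousOn (fun p : ℝ × ℝ => g2 (x + p.1 • cis p.2)) (Icc δ R ×ˢ univ) :=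
    ((contDiffOn_fderiv hU hu).continuousOn_fderiv_of_isOpen hU le_rfl).comp hE hEm
  have hfst : ContinuousOn (fun p : ℝ × ℝ => p.1) (Icc δ R ×ˢ (univ : Set ℝ)) :=
    continuous_fst.continuousOn
  have hfm : MapsTo (fun p : ℝ × ℝ => p.1) (Icc δ R ×ˢ (univ : Set ℝ)) (Ioi 0) :=
    fun p hp => hpos _ hp.1
  have cA : ContinuousOn (fun p : ℝ × ℝ => A p.1) (Icc δ R ×ˢ univ) :=
    ContinuousOn.comp (g := A) (t := Ioi 0)
      (fun r hr => (hA r hr).continuousAt.continuousWithinAt) hfst hfm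
  have cA1 : ContinuousOn (fun p : ℝ × ℝ => A1 p.1) (Icc δ R ×ˢ univ) :=
    ContinuousOn.comp (g := A1) (t := Ioi 0)
      (fun r hr => (hA1 r hr).continuousAt.continuousWithinAt) hfst hfm
  have cA2 : ContinuousOn (fun p : ℝ × ℝ => A2 p.1) (Icc δ R ×ˢ univ) := hA2.comp hfst hfm
  have hcc : Continuous c := continuous_iff_continuousAt.2 fun θ => (hc θ).continuousAt
  have ccis := continuous_cis
  have cc : ContinuousOn (fun p : ℝ × ℝ => c p.2) (Icc δ R ×ˢ univ) :=
    (hcc.comp continuous_snd).continuousOn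
  have cc2 : ContinuousOn (fun p : ℝ × ℝ => c2 p.2) (Icc δ R ×ˢ univ) :=
    (hc2.comp continuous_snd).continuousOn
  have ccs : ContinuousOn (fun p : ℝ × ℝ => cis p.2) (Icc δ R ×ˢ univ) :=
    (ccis.comp continuous_snd).continuousOn
  have cPr : ContinuousOn (fun p : ℝ × ℝ => Pr p.1 p.2) (Icc δ R ×ˢ univ) := by
    simp only [hPr]
    have a1 := cg1.clm_apply ccs
    have a2 := (cg2.clm_apply ccs).clm_apply ccs
    exact (((cA.mul a1).add ((hfst.mul cA).mul a2)).sub ((cA1.add (hfst.mul cA2)).mul cu)).mul cc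
  have cQt : ContinuousOn (fun p : ℝ × ℝ => Qt p.1 p.2) (Icc δ R ×ˢ univ) := by
    simp only [hQt]
    have b := ccs.mul (continuousOn_const (c := Complex.I))
    have a1 := cg1.clm_apply ccs
    have a2 := (cg2.clm_apply b).clm_apply b
    exact ((cA.mul ((hfst.mul a2).sub a1)).mul cc).sub
      (((cA.div hfst fun p hp => (hpos _ hp.1).ne').mul cu).mul cc2)
  have hpi : -Real.pi ≤ Real.pi := by linarith [Real.pi_pos]
  have hQ0 : ∀ r ∈ Icc δ R, ∫ θ in (-Real.pi)..Real.pi, Qt r θ = 0 := by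
    intro r hr
    rw [intervalIntegral.integral_eq_sub_of_hasDerivAt (fun θ _ => hQ r hr θ)]
    · simp [cis_neg_pi_eq, hcp, hc1p]
    · apply ContinuousOn.intervalIntegrable
      exact cQt.comp (f := fun θ : ℝ => (r, θ)) (by fun_prop) fun θ _ => ⟨hr, trivial⟩
  have hPθ : ∀ θ, ∫ r in δ..R, Pr r θ = R * (A R * g1 (x + R • cis θ) (cis θ)
      - A1 R * u (x + R • cis θ)) * c θ - δ * (A δ * g1 (x + δ • cis θ) (cis θ)
      - A1 δ * u (x + δ • cis θ)) * c θ := by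
    intro θ
    rw [intervalIntegral.integral_eq_sub_of_hasDerivAt
      (fun r hr => hP θ r (by rwa [uIcc_of_le hδR] at hr))]
    apply ContinuousOn.intervalIntegrable
    rw [uIcc_of_le hδR]
    exact cPr.comp (f := fun r : ℝ => (r, θ)) (by fun_prop) fun r hr => ⟨hr, trivial⟩
  have hslice : ∀ r ∈ Icc δ R, IntervalIntegrable (fun θ => Pr r θ) volume (-Real.pi) Real.pi := by
    intro r hr
    apply ContinuousOn.intervalIntegrable
    exact cPr.comp (f := fun θ : ℝ => (r, θ)) (by fun_prop) fun θ _ => ⟨hr, trivial⟩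
  have hsliceQ : ∀ r ∈ Icc δ R, IntervalIntegrable (fun θ => Qt r θ) volume (-Real.pi) Real.pi := by
    intro r hr
    apply ContinuousOn.intervalIntegrable
    exact cQt.comp (f := fun θ : ℝ => (r, θ)) (by fun_prop) fun θ _ => ⟨hr, trivial⟩
  have step1 : ∫ r in δ..R, ∫ θ in (-Real.pi)..Real.pi,
        r * (A r * c θ * lap u (x + r • cis θ))
      = ∫ r in δ..R, ∫ θ in (-Real.pi)..Real.pi, Pr r θ := by
    apply intervalIntegral.integral_congr
    intro r hr
    rw [uIcc_of_le hδR] at hr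
    simp only
    rw [intervalIntegral.integral_congr (fun θ _ => hsplit r hr θ),
      intervalIntegral.integral_add (hslice r hr) (hsliceQ r hr), hQ0 r hr, add_zero]
  have step2 : ∫ r in δ..R, ∫ θ in (-Real.pi)..Real.pi, Pr r θ
      = ∫ θ in (-Real.pi)..Real.pi, ∫ r in δ..R, Pr r θ := by
    rw [intervalIntegral.integral_of_le hpi]
    simp_rw [intervalIntegral.integral_of_le hpi]
    apply intervalIntegral_integral_swap
    rw [uIoc_of_le hδR, Measure.prod_restrict]
    refine IntegrableOn.mono_set ?_ (prod_mono Ioc_subset_Icc_self Ioc_subset_Icc_self)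
    exact (cPr.mono (by gcongr; simp)).integrableOn_compact (isCompact_Icc.prod isCompact_Icc)
  rw [step1, step2]
  simp_rw [hPθ]
  have hbd : ∀ r ∈ Icc δ R, IntervalIntegrable (fun θ => r * (A r * g1 (x + r • cis θ) (cis θ)
      - A1 r * u (x + r • cis θ)) * c θ) volume (-Real.pi) Real.pi := by
    intro r hr
    apply ContinuousOn.intervalIntegrable
    have m : MapsTo (fun θ : ℝ => (r, θ)) (uIcc (-Real.pi) Real.pi) (Icc δ R ×ˢ univ) :=
      fun θ _ => ⟨hr, trivial⟩
    have cont : ContinuousOn (fun θ : ℝ => (r, θ)) (uIcc (-Real.pi) Real.pi) := by fun_prop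
    exact ((hfst.mul ((cA.mul (cg1.clm_apply ccs)).sub (cA1.mul cu))).mul cc).comp cont m
  rw [intervalIntegral.integral_sub (hbd R ⟨hδR, le_rfl⟩) (hbd δ ⟨le_rfl, hδR⟩)]

lemma polarCoord_symm_eq (p : ℝ × ℝ) : Complex.polarCoord.symm p = p.1 • cis p.2 := by
  rw [Complex.polarCoord_symm_apply, cis_eq]
  apply Complex.ext <;> simp [-Complex.ofReal_cos, -Complex.ofReal_sin]

/-- Polar coordinates on an annulus. -/
lemma integral_annulus_polar {h : ℂ → ℝ} {x : ℂ} {δ R : ℝ} (hδ : 0 ≤ δ) (hδR : δ ≤ R)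
    (hc : ContinuousOn h (closedBall x R \ ball x δ)) :
    ∫ y in ball x R \ closedBall x δ, h y
      = ∫ r in δ..R, ∫ θ in (-Real.pi)..Real.pi, r * h (x + r • cis θ) := by
  have hpi : -Real.pi ≤ Real.pi := by linarith [Real.pi_pos]
  have hS : MeasurableSet (ball x R \ closedBall x δ) := measurableSet_ball.diff measurableSet_closedBall
  rw [← integral_indicator hS, ← integral_add_left_eq_self _ x,
    ← Complex.integral_comp_polarCoord_symm, intervalIntegral.integral_of_le hδR]
  simp_rw [intervalIntegral.integral_of_le hpi]
  rw [← setIntegral_prod (f := fun p : ℝ × ℝ => p.1 * h (x + p.1 • cis p.2))]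
  · have hT : MeasurableSet (Ioo δ R ×ˢ Ioo (-Real.pi) Real.pi) :=
      measurableSet_Ioo.prod measurableSet_Ioo
    have e1 : ∫ p in Ioc δ R ×ˢ Ioc (-Real.pi) Real.pi, p.1 * h (x + p.1 • cis p.2)
        ∂(volume.prod volume)
        = ∫ p in Ioo δ R ×ˢ Ioo (-Real.pi) Real.pi, p.1 * h (x + p.1 • cis p.2) := by
      apply setIntegral_congr_set
      exact Measure.set_prod_ae_eq Ioo_ae_eq_Ioc.symm Ioo_ae_eq_Ioc.symm
    rw [e1, ← integral_indicator hT, ← integral_indicator polarCoord.open_target.measurableSet]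
    congr 1
    ext p
    simp only [indicator, polarCoord_target, mem_prod, mem_Ioi, mem_Ioo, polarCoord_symm_eq,
      Set.mem_sdiff, mem_ball, mem_closedBall, dist_self_add_left, norm_smul, norm_cis, mul_one,
      Real.norm_eq_abs, smul_eq_mul]
    by_cases hp : 0 < p.1
    · simp only [hp, true_and, abs_of_pos hp]
      split_ifs <;> first | rfl | simp_all
    · have : ¬ (δ < p.1) := fun h' => hp (hδ.trans_lt h')
      simp [hp, this]
  · refine IntegrableOn.mono_set (t := Icc δ R ×ˢ Icc (-Real.pi) Real.pi) ?_
      (prod_mono Ioc_subset_Icc_self Ioc_subset_Icc_self)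
    apply ContinuousOn.integrableOn_compact (isCompact_Icc.prod isCompact_Icc)
    apply continuousOn_fst.mul
    apply hc.comp (continuous_polar x).continuousOn
    rintro p ⟨hp, -⟩
    have := hδ.trans hp.1
    simp [abs_of_nonneg this, hp.1, hp.2]

lemma radial_inv_aux {R : ℝ} :
    (fun y : ℝ => y ^ (Module.finrank ℝ ℂ - 1) • (Iio R).indicator (fun s : ℝ => s⁻¹) y)
      =ᵐ[volume.restrict (Ioi 0)] (Iio R).indicator (fun _ => (1 : ℝ)) := by
  filter_upwards [ae_restrict_mem measurableSet_Ioi] with y hy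
  have : y ≠ 0 := (mem_Ioi.1 hy).ne'
  by_cases h : y < R <;> simp [h, this, Complex.finrank_real_complex]

lemma indicator_inv_dist (x : ℂ) (R : ℝ) :
    (ball x R).indicator (fun y : ℂ => ‖y - x‖⁻¹)
      = fun y => (Iio R).indicator (fun s : ℝ => s⁻¹) ‖y - x‖ := by
  ext y
  simp only [indicator, mem_ball, mem_Iio, dist_eq_norm]

lemma integrableOn_inv_dist (x : ℂ) (R : ℝ) :
    IntegrableOn (fun y : ℂ => ‖y - x‖⁻¹) (ball x R) := by
  rw [← integrable_indicator_iff measurableSet_ball, indicator_inv_dist]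
  apply Integrable.comp_sub_right (f := fun y : ℂ => (Iio R).indicator (fun s : ℝ => s⁻¹) ‖y‖)
  rw [integrable_fun_norm_addHaar volume (f := (Iio R).indicator (fun s : ℝ => s⁻¹)),
    integrableOn_congr_fun_ae radial_inv_aux, IntegrableOn, integrable_indicator_iff measurableSet_Iio,
    IntegrableOn, Measure.restrict_restrict measurableSet_Iio]
  apply (integrableOn_const (s := Ioo 0 R) (by simp)).mono_set
  intro y hy; exact ⟨hy.2, hy.1⟩

lemma integral_inv_dist (x : ℂ) {R : ℝ} (hR : 0 ≤ R) :
    ∫ y in ball x R, ‖y - x‖⁻¹ = 2 * Real.pi * R := by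
  rw [← integral_indicator measurableSet_ball, indicator_inv_dist,
    integral_sub_right_eq_self (fun y : ℂ => (Iio R).indicator (fun s : ℝ => s⁻¹) ‖y‖) x,
    integral_fun_norm_addHaar volume (f := (Iio R).indicator (fun s : ℝ => s⁻¹)),
    integral_congr_ae radial_inv_aux, setIntegral_indicator measurableSet_Iio]
  have : Ioi (0:ℝ) ∩ Iio R = Ioo 0 R := rfl
  rw [this]
  simp [Complex.finrank_real_complex, measureReal_def, hR]
  ring

/-- An integral over a ball is the limit of integrals over punctured balls. -/
lemma tendsto_annulus {h : ℂ → ℝ} {x : ℂ} {R : ℝ} (hh : IntegrableOn h (ball x R)) :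
    Tendsto (fun n : ℕ => ∫ y in ball x R \ closedBall x (R / (n + 2)), h y) atTop
      (nhds (∫ y in ball x R, h y)) := by
  by_cases hR : 0 < R
  swap
  · simp [ball_eq_empty.2 (not_lt.1 hR)]
  have hU : (⋃ n : ℕ, ball x R \ closedBall x (R / (n + 2))) = ball x R \ {x} := by
    rw [← sdiff_iInter]
    congr 1
    ext y
    simp only [mem_iInter, mem_closedBall, mem_singleton_iff]
    constructor
    · intro hy
      rw [← dist_le_zero]
      have : Tendsto (fun n : ℕ => R / ((n : ℝ) + 2)) atTop (nhds 0) :=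
        tendsto_const_nhds.div_atTop (tendsto_natCast_atTop_atTop.atTop_add tendsto_const_nhds)
      exact ge_of_tendsto' this hy
    · rintro rfl n
      simp; positivity
  have hi : ∫ y in ball x R, h y = ∫ y in ball x R \ {x}, h y :=
    setIntegral_congr_set (sdiff_null_ae_eq_self (by simp)).symm
  rw [hi, ← hU]
  apply tendsto_setIntegral_of_monotone
  · exact fun n => measurableSet_ball.diff measurableSet_closedBall
  · intro m n hmn
    apply sdiff_subset_sdiff_right
    apply closedBall_subset_closedBall
    have : (m : ℝ) ≤ n := by exact_mod_cast hmn
    gcongr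
  · rw [hU]; exact hh.mono_set sdiff_subset

section

variable {u : ℂ → ℝ} {U : Set ℂ} {x : ℂ} {R : ℝ}

lemma intervalIntegrable_circle {g : ℂ → ℝ} (hg : ContinuousOn g (closedBall x R)) {r : ℝ}
    (hr0 : 0 ≤ r) (hr : r ≤ R) {c : ℝ → ℝ} (hc : Continuous c) :
    IntervalIntegrable (fun θ => g (x + r • cis θ) * c θ) volume (-Real.pi) Real.pi := by
  apply Continuous.intervalIntegrable
  refine Continuous.mul ?_ hc
  exact hg.comp_continuous (by have := continuous_cis; fun_prop) fun θ => polar_mem hr0 hr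

/-- Circle integrals converge to the value at the centre as the radius tends to zero. -/
lemma tendsto_circle {g : ℂ → ℝ} (hR : 0 < R) (hg : ContinuousOn g (closedBall x R))
    {c : ℝ → ℝ} (hc : Continuous c) :
    Tendsto (fun n : ℕ => ∫ θ in (-Real.pi)..Real.pi, g (x + (R / (n + 2)) • cis θ) * c θ) atTop
      (nhds (∫ θ in (-Real.pi)..Real.pi, g x * c θ)) := by
  obtain ⟨B, hB⟩ := (isCompact_closedBall x R).exists_bound_of_continuousOn hg
  have hle : ∀ n : ℕ, R / ((n : ℝ) + 2) ≤ R := fun n =>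
    div_le_self hR.le (by have : (0:ℝ) ≤ n := n.cast_nonneg; linarith)
  have h0 : ∀ n : ℕ, 0 ≤ R / ((n : ℝ) + 2) := fun n => by positivity
  refine intervalIntegral.tendsto_integral_filter_of_dominated_convergence
    (fun θ => B * |c θ|) ?_ ?_ ?_ ?_
  · refine Eventually.of_forall fun n => ?_
    exact ((intervalIntegrable_circle hg (h0 n) (hle n) hc).1).aestronglyMeasurable.mono_measure
      (by rw [uIoc_of_le (by linarith [Real.pi_pos])])
  · refine Eventually.of_forall fun n => Eventually.of_forall fun θ _ => ?_
    rw [norm_mul]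
    exact mul_le_mul_of_nonneg_right (hB _ (polar_mem (h0 n) (hle n))) (abs_nonneg _)
  · apply Continuous.intervalIntegrable; fun_prop
  · refine Eventually.of_forall fun θ _ => ?_
    refine Tendsto.mul_const _ ?_
    have hlim : Tendsto (fun n : ℕ => R / ((n : ℝ) + 2)) atTop (nhds 0) :=
      tendsto_const_nhds.div_atTop (tendsto_natCast_atTop_atTop.atTop_add tendsto_const_nhds)
    have h1 : Tendsto (fun n : ℕ => x + (R / ((n : ℝ) + 2)) • cis θ) atTop (nhds x) := by
      simpa using (hlim.smul_const (cis θ)).const_add x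
    exact ((hg.continuousAt (closedBall_mem_nhds x hR)).tendsto).comp h1

lemma integrableOn_of_inv_bound {h : ℂ → ℝ} {B : ℝ}
    (hc : ContinuousOn h (closedBall x R \ {x})) (hb : ∀ y ∈ ball x R, |h y| ≤ B * ‖y - x‖⁻¹) :
    IntegrableOn h (ball x R) := by
  have h1 : IntegrableOn (fun y => B * ‖y - x‖⁻¹) (ball x R) :=
    (integrableOn_inv_dist x R).const_mul B
  refine Integrable.mono' h1 ?_ ((ae_restrict_iff' measurableSet_ball).2 (Eventually.of_forall hb))
  have h2 : volume.restrict (ball x R) = volume.restrict (ball x R \ {x}) :=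
    Measure.restrict_congr_set (sdiff_null_ae_eq_self (by simp)).symm
  rw [h2]
  exact (hc.mono (sdiff_subset_sdiff_left ball_subset_closedBall)).aestronglyMeasurable
    (measurableSet_ball.diff (measurableSet_singleton x))

/-- Annulus integrals in polar coordinates tend to the integral over the ball. -/
lemma tendsto_polar {h : ℂ → ℝ} {B : ℝ} (hR : 0 < R)
    (hc : ContinuousOn h (closedBall x R \ {x})) (hb : ∀ y ∈ ball x R, |h y| ≤ B * ‖y - x‖⁻¹) :
    Tendsto (fun n : ℕ => ∫ r in (R / (n + 2))..R, ∫ θ in (-Real.pi)..Real.pi,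
      r * h (x + r • cis θ)) atTop (nhds (∫ y in ball x R, h y)) := by
  refine (tendsto_annulus (integrableOn_of_inv_bound hc hb)).congr fun n => ?_
  apply integral_annulus_polar (by positivity)
    (div_le_self hR.le (by have : (0:ℝ) ≤ n := n.cast_nonneg; linarith))
  refine hc.mono fun y hy => ⟨hy.1, ?_⟩
  rintro rfl
  have : 0 < R / ((n:ℝ) + 2) := by positivity
  exact hy.2 (mem_ball_self this)

lemma abs_log_div_le {R s : ℝ} (hs : 0 ≤ s) (hR : s ≤ R) : |Real.log (R / s)| ≤ R * s⁻¹ := by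
  rcases hs.eq_or_lt with rfl | hs
  · simp
  have h1 : 1 ≤ R / s := (one_le_div hs).2 hR
  rw [abs_of_nonneg (Real.log_nonneg h1), ← div_eq_mul_inv]
  exact (Real.log_le_sub_one_of_pos (by linarith)).trans (by linarith)

lemma integrableOn_log_mul (hR : 0 < R) {g : ℂ → ℝ} (hg : ContinuousOn g (closedBall x R)) :
    IntegrableOn (fun y => Real.log (R / ‖y - x‖) * g y) (ball x R) ∧
    Tendsto (fun n : ℕ => ∫ r in (R / (n + 2))..R, ∫ θ in (-Real.pi)..Real.pi,
      r * (Real.log (R / r) * g (x + r • cis θ))) atTop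
      (nhds (∫ y in ball x R, Real.log (R / ‖y - x‖) * g y)) := by
  obtain ⟨B, hB⟩ := (isCompact_closedBall x R).exists_bound_of_continuousOn hg
  have hc : ContinuousOn (fun y => Real.log (R / ‖y - x‖) * g y) (closedBall x R \ {x}) := by
    have h1 : ∀ y ∈ closedBall x R \ {x}, ‖y - x‖ ≠ 0 := fun y hy => by
      simpa [sub_eq_zero] using hy.2
    refine ContinuousOn.mul (ContinuousOn.log (ContinuousOn.div (by fun_prop) (by fun_prop) h1) ?_)
      (hg.mono sdiff_subset)
    exact fun y hy => div_ne_zero hR.ne' (h1 y hy)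
  have hb : ∀ y ∈ ball x R, |Real.log (R / ‖y - x‖) * g y| ≤ (R * B) * ‖y - x‖⁻¹ := fun y hy => by
    rw [abs_mul]
    calc _ ≤ (R * ‖y - x‖⁻¹) * B := by
          gcongr
          · exact abs_log_div_le (norm_nonneg _) (by simpa [dist_eq_norm] using (mem_ball.1 hy).le)
          · exact hB y (ball_subset_closedBall hy)
      _ = _ := by ring
  refine ⟨integrableOn_of_inv_bound hc hb, (tendsto_polar hR hc hb).congr fun n => ?_⟩
  apply intervalIntegral.integral_congr
  intro r hr
  have h2 : R / ((n:ℝ) + 2) ≤ R :=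
    (div_le_self hR.le (by have : (0:ℝ) ≤ n := n.cast_nonneg; linarith))
  rw [uIcc_of_le h2] at hr
  have h3 : 0 ≤ r := le_trans (by positivity) hr.1
  simp [abs_of_nonneg h3]

/-- Poisson–Jensen formula for the value at the centre of a disc. -/
theorem log_rep (hU : IsOpen U) (hu : ContDiffOn ℝ 2 u U) (hR : 0 < R) (hx : closedBall x R ⊆ U) :
    ∫ y in ball x R, Real.log (R / ‖y - x‖) * lap u y
      = (∫ θ in (-Real.pi)..Real.pi, u (x + R • cis θ)) - 2 * Real.pi * u x := by
  have hlap := (continuousOn_lap hU hu).mono hx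
  have huc := hu.continuousOn.mono hx
  have hfc := (contDiffOn_fderiv hU hu).continuousOn.mono hx
  refine tendsto_nhds_unique (integrableOn_log_mul hR hlap).2 ?_
  obtain ⟨G, hG⟩ := (isCompact_closedBall x R).exists_bound_of_continuousOn hfc
  have hlim : Tendsto (fun n : ℕ => R / ((n : ℝ) + 2)) atTop (nhds 0) :=
      tendsto_const_nhds.div_atTop (tendsto_natCast_atTop_atTop.atTop_add tendsto_const_nhds)
  have hle : ∀ n : ℕ, R / ((n : ℝ) + 2) ≤ R := fun n =>
    div_le_self hR.le (by have : (0:ℝ) ≤ n := n.cast_nonneg; linarith)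
  have h0 : ∀ n : ℕ, 0 < R / ((n : ℝ) + 2) := fun n => by positivity
  have key : ∀ n : ℕ, ∫ r in (R / (n + 2))..R, ∫ θ in (-Real.pi)..Real.pi,
      r * (Real.log (R / r) * lap u (x + r • cis θ))
      = (∫ θ in (-Real.pi)..Real.pi, u (x + R • cis θ))
        - ((R / (n + 2) * Real.log (R / (R / (n + 2)))) *
            (∫ θ in (-Real.pi)..Real.pi, fderiv ℝ u (x + (R / (n + 2)) • cis θ) (cis θ))
          + ∫ θ in (-Real.pi)..Real.pi, u (x + (R / (n + 2)) • cis θ) * 1) := by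
    intro n
    have := green_polar (A := fun r => Real.log (R / r)) (A1 := fun r => - r⁻¹)
      (A2 := fun r => (r ^ 2)⁻¹) (c := fun _ => 1) (c1 := fun _ => 0) (c2 := fun _ => 0)
      hU hu (h0 n) (hle n) hx ?_ ?_ ?_ ?_ ?_ ?_ ?_ ?_ ?_
    · simp only [mul_one] at this ⊢
      rw [this]
      congr 1
      · apply intervalIntegral.integral_congr
        intro θ _
        simp only [div_self hR.ne', Real.log_one]
        field_simp
        ring
      · rw [← intervalIntegral.integral_const_mul, ← intervalIntegral.integral_add]
        · apply intervalIntegral.integral_congr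
          intro θ _
          have := (h0 n).ne'
          field_simp
          ring
        · apply Continuous.intervalIntegrable
          apply continuous_const.mul
          refine Continuous.clm_apply (hfc.comp_continuous ?_ fun θ => polar_mem (h0 n).le (hle n))
            continuous_cis
          have := continuous_cis; fun_prop
        · simpa using intervalIntegrable_circle huc (h0 n).le (hle n) (c := fun _ => 1) continuous_const
    · intro r hr
      have h := (((hasDerivAt_const r R).div (hasDerivAt_id r) hr.ne').log
        (div_ne_zero hR.ne' hr.ne'))
      refine HasDerivAt.congr_deriv h ?_
      simp
      field_simp
    · intro r hr
      refine HasDerivAt.congr_deriv (hasDerivAt_inv hr.ne').neg ?_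
      simp
    · refine ContinuousOn.inv₀ (by fun_prop) fun r hr => pow_ne_zero _ (mem_Ioi.1 hr).ne'
    · intro θ; exact hasDerivAt_const _ _
    · intro θ; exact hasDerivAt_const _ _
    · fun_prop
    · rfl
    · rfl
    · intro r hr θ; field_simp; ring
  simp_rw [key]
  refine Tendsto.const_sub _ ?_
  have e : (2 * Real.pi * u x) = 0 + ∫ θ in (-Real.pi)..Real.pi, u x * 1 := by
    rw [intervalIntegral.integral_const, smul_eq_mul]; ring
  rw [e]
  refine Tendsto.add ?_ (tendsto_circle hR huc continuous_const)
  have hb : ∀ n : ℕ, ‖∫ θ in (-Real.pi)..Real.pi, fderiv ℝ u (x + (R / (n + 2)) • cis θ) (cis θ)‖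
      ≤ G * |Real.pi - -Real.pi| := fun n => by
    apply intervalIntegral.norm_integral_le_of_norm_le_const
    intro θ _
    refine (ContinuousLinearMap.le_opNorm _ _).trans ?_
    rw [norm_cis, mul_one]
    exact hG _ (polar_mem (h0 n).le (hle n))
  refine Tendsto.zero_mul_isBoundedUnder_le ?_ (isBoundedUnder_of ⟨_, hb⟩)
  have h3 : Tendsto (fun s : ℝ => s * Real.log R - Real.log s * s) (nhdsWithin 0 (Ioi 0)) (nhds 0) := by
    have h4 : Tendsto (fun s : ℝ => s * Real.log R) (nhdsWithin 0 (Ioi 0)) (nhds 0) := by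
      have : Tendsto (fun s : ℝ => s * Real.log R) (nhds 0) (nhds (0 * Real.log R)) :=
        (continuous_id.mul continuous_const).tendsto 0
      rw [zero_mul] at this
      exact this.mono_left nhdsWithin_le_nhds
    simpa using h4.sub (tendsto_log_mul_rpow_nhdsGT_zero one_pos)
  have h5 : Tendsto (fun n : ℕ => R / ((n : ℝ) + 2)) atTop (nhdsWithin 0 (Ioi 0)) :=
    tendsto_nhdsWithin_iff.2 ⟨hlim, Eventually.of_forall h0⟩
  refine (h3.comp h5).congr fun n => ?_
  simp only [Function.comp]
  rw [Real.log_div hR.ne' (h0 n).ne']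
  ring

end

section

variable {u : ℂ → ℝ} {U : Set ℂ} {x : ℂ} {R : ℝ}

lemma inner_cis (w : ℂ) (θ : ℝ) : inner ℝ w (cis θ) = w.re * Real.cos θ + w.im * Real.sin θ := by
  rw [cis_eq, Complex.inner]; simp; ring

lemma continuous_inner_cis (w : ℂ) : Continuous fun θ => inner ℝ w (cis θ) := by
  have := continuous_cis; fun_prop

lemma integral_inner_cis (w : ℂ) : ∫ θ in (-Real.pi)..Real.pi, inner ℝ w (cis θ) = 0 := by
  simp_rw [inner_cis]
  rw [intervalIntegral.integral_add (by apply Continuous.intervalIntegrable; fun_prop)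
    (by apply Continuous.intervalIntegrable; fun_prop),
    intervalIntegral.integral_const_mul, intervalIntegral.integral_const_mul]
  simp

lemma integral_clm_mul_inner_cis (g : ℂ →L[ℝ] ℝ) (w : ℂ) :
    ∫ θ in (-Real.pi)..Real.pi, g (cis θ) * inner ℝ w (cis θ) = Real.pi * g w := by
  have hg : ∀ z : ℂ, g z = g 1 * z.re + g Complex.I * z.im := fun z => by
    conv_lhs => rw [← Complex.re_add_im z]
    have h1 : (z.re : ℂ) = z.re • (1 : ℂ) := by simp
    have h2 : (z.im : ℂ) * Complex.I = z.im • Complex.I := by simp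
    rw [h1, h2, map_add, map_smul, map_smul, smul_eq_mul, smul_eq_mul]; ring
  simp_rw [inner_cis, hg (cis _), cis_eq]
  have e : ∀ θ : ℝ, (g 1 * Real.cos θ + g Complex.I * Real.sin θ) *
      (w.re * Real.cos θ + w.im * Real.sin θ) = (g 1 * w.re) * Real.cos θ ^ 2 +
      (g 1 * w.im + g Complex.I * w.re) * (Real.sin θ * Real.cos θ)
      + (g Complex.I * w.im) * Real.sin θ ^ 2 := fun θ => by ring
  simp_rw [e]
  rw [intervalIntegral.integral_add (by apply Continuous.intervalIntegrable; fun_prop)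
    (by apply Continuous.intervalIntegrable; fun_prop), intervalIntegral.integral_add
    (by apply Continuous.intervalIntegrable; fun_prop)
    (by apply Continuous.intervalIntegrable; fun_prop)]
  simp_rw [intervalIntegral.integral_const_mul]
  rw [integral_cos_sq, integral_sin_sq, integral_sin_mul_cos₁, hg w]
  simp
  ring

lemma abs_grad_kernel_le {y w : ℂ} (hy : y ∈ ball x R) :
    |inner ℝ w (y - x) * ((‖y - x‖ ^ 2)⁻¹ - (R ^ 2)⁻¹)| ≤ ‖w‖ * ‖y - x‖⁻¹ := by
  rcases eq_or_ne y x with rfl | h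
  · simp
  have hs : 0 < ‖y - x‖ := norm_pos_iff.2 (sub_ne_zero.2 h)
  have hyR : ‖y - x‖ < R := by simpa [dist_eq_norm] using hy
  rw [abs_mul]
  have h1 : |(‖y - x‖ ^ 2)⁻¹ - (R ^ 2)⁻¹| ≤ (‖y - x‖ ^ 2)⁻¹ := by
    have h2 : (R ^ 2)⁻¹ ≤ (‖y - x‖ ^ 2)⁻¹ := by gcongr
    have h3 : 0 ≤ (R ^ 2)⁻¹ := by positivity
    rw [abs_of_nonneg (by linarith)]; linarith
  calc _ ≤ (‖w‖ * ‖y - x‖) * (‖y - x‖ ^ 2)⁻¹ := by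
        gcongr; exact abs_real_inner_le_norm w (y - x)
    _ = _ := by field_simp

lemma grad_kernel_mul (hR : 0 < R) {g : ℂ → ℝ} (hg : ContinuousOn g (closedBall x R)) (w : ℂ) :
    IntegrableOn (fun y => inner ℝ w (y - x) * ((‖y - x‖ ^ 2)⁻¹ - (R ^ 2)⁻¹) * g y) (ball x R) ∧
    Tendsto (fun n : ℕ => ∫ r in (R / (n + 2))..R, ∫ θ in (-Real.pi)..Real.pi,
      r * ((r⁻¹ - r / R ^ 2) * inner ℝ w (cis θ) * g (x + r • cis θ))) atTop
      (nhds (∫ y in ball x R, inner ℝ w (y - x) * ((‖y - x‖ ^ 2)⁻¹ - (R ^ 2)⁻¹) * g y)) := by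
  obtain ⟨B, hB⟩ := (isCompact_closedBall x R).exists_bound_of_continuousOn hg
  have hc : ContinuousOn (fun y => inner ℝ w (y - x) * ((‖y - x‖ ^ 2)⁻¹ - (R ^ 2)⁻¹) * g y)
      (closedBall x R \ {x}) := by
    refine ContinuousOn.mul (ContinuousOn.mul (by fun_prop) (ContinuousOn.sub (ContinuousOn.inv₀
      (by fun_prop) ?_) continuousOn_const)) (hg.mono sdiff_subset)
    exact fun y hy => by simpa [sub_eq_zero] using hy.2
  have hb : ∀ y ∈ ball x R, |inner ℝ w (y - x) * ((‖y - x‖ ^ 2)⁻¹ - (R ^ 2)⁻¹) * g y|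
      ≤ (‖w‖ * B) * ‖y - x‖⁻¹ := fun y hy => by
    rw [abs_mul]
    calc _ ≤ (‖w‖ * ‖y - x‖⁻¹) * B :=
          mul_le_mul (abs_grad_kernel_le hy) (hB y (ball_subset_closedBall hy)) (abs_nonneg _)
            (by positivity)
      _ = _ := by ring
  refine ⟨integrableOn_of_inv_bound hc hb, (tendsto_polar hR hc hb).congr fun n => ?_⟩
  apply intervalIntegral.integral_congr
  intro r hr
  have h2 : R / ((n:ℝ) + 2) ≤ R :=
    (div_le_self hR.le (by have : (0:ℝ) ≤ n := n.cast_nonneg; linarith))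
  rw [uIcc_of_le h2] at hr
  have h3 : 0 < r := lt_of_lt_of_le (by positivity) hr.1
  simp only [add_sub_cancel_left, norm_smul, norm_cis, Real.norm_eq_abs, abs_of_pos h3, mul_one,
    inner_smul_right]
  apply intervalIntegral.integral_congr
  intro θ _
  simp only
  field_simp

/-- Representation of the gradient at the centre of a disc. -/
theorem grad_rep (hU : IsOpen U) (hu : ContDiffOn ℝ 2 u U) (hR : 0 < R) (hx : closedBall x R ⊆ U)
    (w : ℂ) :
    ∫ y in ball x R, inner ℝ w (y - x) * ((‖y - x‖ ^ 2)⁻¹ - (R ^ 2)⁻¹) * lap u y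
      = 2 / R * (∫ θ in (-Real.pi)..Real.pi, u (x + R • cis θ) * inner ℝ w (cis θ))
        - 2 * Real.pi * fderiv ℝ u x w := by
  have hlap := (continuousOn_lap hU hu).mono hx
  have huc := hu.continuousOn.mono hx
  have hfc := (contDiffOn_fderiv hU hu).continuousOn.mono hx
  refine tendsto_nhds_unique (grad_kernel_mul hR hlap w).2 ?_
  have hxm : x ∈ closedBall x R := mem_closedBall_self hR.le
  have hlim : Tendsto (fun n : ℕ => R / ((n : ℝ) + 2)) atTop (nhds 0) :=
      tendsto_const_nhds.div_atTop (tendsto_natCast_atTop_atTop.atTop_add tendsto_const_nhds)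
  have hle : ∀ n : ℕ, R / ((n : ℝ) + 2) ≤ R := fun n =>
    div_le_self hR.le (by have : (0:ℝ) ≤ n := n.cast_nonneg; linarith)
  have h0 : ∀ n : ℕ, 0 < R / ((n : ℝ) + 2) := fun n => by positivity
  have hcw := continuous_inner_cis w
  obtain ⟨G, hG⟩ := (isCompact_closedBall x R).exists_bound_of_continuousOn hfc
  have hpt : ∀ θ, Tendsto (fun n : ℕ => x + (R / ((n : ℝ) + 2)) • cis θ) atTop (nhds x) := fun θ => by
    simpa using (hlim.smul_const (cis θ)).const_add x
  have i1 : ∀ n : ℕ, IntervalIntegrable (fun θ => fderiv ℝ u (x + (R / ((n:ℝ) + 2)) • cis θ) (cis θ)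
      * inner ℝ w (cis θ)) volume (-Real.pi) Real.pi := fun n => by
    apply Continuous.intervalIntegrable
    refine Continuous.mul (Continuous.clm_apply (hfc.comp_continuous ?_
      fun θ => polar_mem (h0 n).le (hle n)) continuous_cis) hcw
    have := continuous_cis; fun_prop
  have i2 : ∀ n : ℕ, IntervalIntegrable (fun θ => (u (x + (R / ((n:ℝ) + 2)) • cis θ) - u x) /
      (R / ((n:ℝ) + 2)) * inner ℝ w (cis θ)) volume (-Real.pi) Real.pi := fun n => by
    apply Continuous.intervalIntegrable
    refine Continuous.mul (Continuous.div_const (Continuous.sub (huc.comp_continuous ?_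
      fun θ => polar_mem (h0 n).le (hle n)) continuous_const) _) hcw
    have := continuous_cis; fun_prop
  have key : ∀ n : ℕ, ∫ r in (R / (n + 2))..R, ∫ θ in (-Real.pi)..Real.pi,
      r * ((r⁻¹ - r / R ^ 2) * inner ℝ w (cis θ) * lap u (x + r • cis θ))
      = 2 / R * (∫ θ in (-Real.pi)..Real.pi, u (x + R • cis θ) * inner ℝ w (cis θ))
        - ((1 - (R / (n + 2)) ^ 2 / R ^ 2) * (∫ θ in (-Real.pi)..Real.pi,
              fderiv ℝ u (x + (R / (n + 2)) • cis θ) (cis θ) * inner ℝ w (cis θ))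
          + (1 + (R / (n + 2)) ^ 2 / R ^ 2) * ∫ θ in (-Real.pi)..Real.pi,
              (u (x + (R / (n + 2)) • cis θ) - u x) / (R / (n + 2)) * inner ℝ w (cis θ)) := by
    intro n
    have hd : ∀ (a b : ℝ) θ, HasDerivAt (fun θ => a * Real.cos θ + b * Real.sin θ)
        (b * Real.cos θ + (-a) * Real.sin θ) θ := fun a b θ => by
      refine HasDerivAt.congr_deriv (((Real.hasDerivAt_cos θ).const_mul a).add
        ((Real.hasDerivAt_sin θ).const_mul b)) ?_
      ring
    have := green_polar (A := fun r => r⁻¹ - r / R ^ 2) (A1 := fun r => - (r ^ 2)⁻¹ - (R ^ 2)⁻¹)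
      (A2 := fun r => 2 * (r ^ 3)⁻¹) (c := fun θ => w.re * Real.cos θ + w.im * Real.sin θ)
      (c1 := fun θ => w.im * Real.cos θ + (-w.re) * Real.sin θ)
      (c2 := fun θ => (-w.re) * Real.cos θ + (-w.im) * Real.sin θ)
      hU hu (h0 n) (hle n) hx ?_ ?_ ?_ (hd _ _) (hd _ _) ?_ ?_ ?_ ?_
    · simp only [inner_cis] at this i1 i2 ⊢
      rw [this]
      congr 1
      · rw [← intervalIntegral.integral_const_mul]
        apply intervalIntegral.integral_congr
        intro θ _
        simp only
        field_simp
        ring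
      · rw [← intervalIntegral.integral_const_mul, ← intervalIntegral.integral_const_mul,
          ← intervalIntegral.integral_add ((i1 n).const_mul _) ((i2 n).const_mul _)]
        have hz := integral_inner_cis w
        simp only [inner_cis] at hz
        have hz2 : ∫ θ in (-Real.pi)..Real.pi, ((1 + (R / ((n:ℝ) + 2)) ^ 2 / R ^ 2) *
          (u x / (R / ((n:ℝ) + 2)))) * (w.re * Real.cos θ + w.im * Real.sin θ) = 0 := by
          rw [intervalIntegral.integral_const_mul, hz, mul_zero]
        rw [← add_zero (∫ θ in (-Real.pi)..Real.pi, (_ : ℝ) + _), ← hz2,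
          ← intervalIntegral.integral_add (((i1 n).const_mul _).add ((i2 n).const_mul _))
            (by apply Continuous.intervalIntegrable; fun_prop)]
        apply intervalIntegral.integral_congr
        intro θ _
        have := (h0 n).ne'
        simp only
        generalize R / ((n:ℝ) + 2) = δ at *
        field_simp
        ring
    · intro r hr
      refine HasDerivAt.congr_deriv ((hasDerivAt_inv hr.ne').sub
        ((hasDerivAt_id r).div_const (R ^ 2))) ?_
      simp
    · intro r hr
      have h := ((hasDerivAt_pow 2 r).inv (pow_ne_zero 2 hr.ne')).neg.sub_const ((R ^ 2)⁻¹)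
      refine HasDerivAt.congr_deriv h ?_
      field_simp
      ring
    · refine ContinuousOn.mul continuousOn_const (ContinuousOn.inv₀ (by fun_prop)
        fun r hr => pow_ne_zero _ (mem_Ioi.1 hr).ne')
    · fun_prop
    · simp
    · simp
    · intro r hr θ; field_simp; ring
  simp_rw [key]
  refine Tendsto.const_sub _ ?_
  have hsq : Tendsto (fun n : ℕ => (R / ((n:ℝ) + 2)) ^ 2 / R ^ 2) atTop (nhds 0) := by
    simpa using (hlim.pow 2).div_const (R ^ 2)
  have l1 : Tendsto (fun n : ℕ => ∫ θ in (-Real.pi)..Real.pi,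
      fderiv ℝ u (x + (R / (n + 2)) • cis θ) (cis θ) * inner ℝ w (cis θ)) atTop
      (nhds (Real.pi * fderiv ℝ u x w)) := by
    rw [← integral_clm_mul_inner_cis]
    refine intervalIntegral.tendsto_integral_filter_of_dominated_convergence
      (fun θ => G * |inner ℝ w (cis θ)|) (Eventually.of_forall fun n =>
        (i1 n).aestronglyMeasurable_restrict_uIoc) ?_
        (Continuous.intervalIntegrable (by fun_prop) _ _) ?_
    · refine Eventually.of_forall fun n => Eventually.of_forall fun θ _ => ?_
      rw [norm_mul]
      refine mul_le_mul_of_nonneg_right ?_ (abs_nonneg _)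
      refine (ContinuousLinearMap.le_opNorm _ _).trans ?_
      rw [norm_cis, mul_one]
      exact hG _ (polar_mem (h0 n).le (hle n))
    · refine Eventually.of_forall fun θ _ => Tendsto.mul_const _ ?_
      exact (((ContinuousLinearMap.apply ℝ ℝ (cis θ)).continuous.tendsto _).comp
        (hfc.continuousAt (closedBall_mem_nhds x hR)).tendsto).comp (hpt θ)
  have l2 : Tendsto (fun n : ℕ => ∫ θ in (-Real.pi)..Real.pi,
      (u (x + (R / (n + 2)) • cis θ) - u x) / (R / (n + 2)) * inner ℝ w (cis θ)) atTop
      (nhds (Real.pi * fderiv ℝ u x w)) := by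
    rw [← integral_clm_mul_inner_cis]
    refine intervalIntegral.tendsto_integral_filter_of_dominated_convergence
      (fun θ => G * |inner ℝ w (cis θ)|) (Eventually.of_forall fun n =>
        (i2 n).aestronglyMeasurable_restrict_uIoc) ?_
        (Continuous.intervalIntegrable (by fun_prop) _ _) ?_
    · refine Eventually.of_forall fun n => Eventually.of_forall fun θ _ => ?_
      rw [norm_mul]
      refine mul_le_mul_of_nonneg_right ?_ (abs_nonneg _)
      have h1 := (convex_closedBall x R).norm_image_sub_le_of_norm_hasFDerivWithin_le
        (fun z hz => (hasFDerivAt_of_mem hU hu (hx hz)).hasFDerivWithinAt) hG hxm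
        (polar_mem (θ := θ) (h0 n).le (hle n))
      rw [add_sub_cancel_left, norm_smul, norm_cis, mul_one, Real.norm_of_nonneg (h0 n).le] at h1
      rw [norm_div, Real.norm_of_nonneg (h0 n).le, div_le_iff₀ (h0 n)]
      exact h1
    · refine Eventually.of_forall fun θ _ => Tendsto.mul_const _ ?_
      have h1 : HasDerivAt (fun s : ℝ => u (x + s • cis θ)) (fderiv ℝ u x (cis θ)) 0 := by
        have h2 := hasFDerivAt_of_mem hU hu (hx hxm)
        rw [← add_zero x, ← zero_smul ℝ (cis θ)] at h2
        have h3 := h2.comp_hasDerivAt (0:ℝ) (hasDerivAt_polar_r x 0 θ)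
        simp only [add_zero, zero_smul] at h3
        exact h3
      have h4 := (hasDerivAt_iff_tendsto_slope_zero.1 h1).comp
        (tendsto_nhdsWithin_iff.2 ⟨hlim, Eventually.of_forall fun n => (h0 n).ne'⟩)
      refine h4.congr fun n => ?_
      simp [div_eq_inv_mul]
  have e : 2 * Real.pi * fderiv ℝ u x w = (1 - 0) * (Real.pi * fderiv ℝ u x w)
      + (1 + 0) * (Real.pi * fderiv ℝ u x w) := by ring
  rw [e]
  exact ((hsq.const_sub 1).mul l1).add ((hsq.const_add 1).mul l2)

end

/-- Minimum principle for superharmonic functions on bounded open sets. -/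
theorem nonneg_of_lap_nonpos {u : ℂ → ℝ} {U : Set ℂ} (hU : IsOpen U) (hb : Bornology.IsBounded U)
    (hu : ContDiffOn ℝ 2 u U) (hc : ContinuousOn u (closure U)) (hlap : ∀ x ∈ U, lap u x ≤ 0)
    (hfr : ∀ x ∈ frontier U, 0 ≤ u x) : ∀ x ∈ closure U, 0 ≤ u x := by
  by_contra! h
  obtain ⟨x0, hx0, hneg⟩ := h
  obtain ⟨ρ, hρ⟩ := hb.closure.subset_closedBall (0 : ℂ)
  have hρ0 : 0 ≤ ρ := by
    have := hρ hx0; simp at this; exact (norm_nonneg _).trans this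
  set ε : ℝ := - u x0 / (2 * (ρ ^ 2 + 1)) with hε
  have hε0 : 0 < ε := by apply div_pos (by linarith); positivity
  set w : ℂ → ℝ := fun x => u x + ε * (ρ ^ 2 - ‖x‖ ^ 2) with hw
  have hK : IsCompact (closure U) := hb.isCompact_closure
  obtain ⟨x1, hx1, hmin⟩ := hK.exists_isMinOn ⟨x0, hx0⟩ (f := w) (hc.add (by fun_prop))
  have hw1 : w x1 < 0 := by
    refine (hmin hx0).trans_lt ?_
    have e : ε * (2 * (ρ ^ 2 + 1)) = - u x0 := by rw [hε]; field_simp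
    have : ε * (ρ ^ 2 - ‖x0‖ ^ 2) ≤ ε * (ρ ^ 2 + 1) := by
      gcongr; nlinarith [sq_nonneg ‖x0‖]
    simp only [hw]; linarith
  have hx1U : x1 ∈ U := by
    by_contra hcon
    have hf : x1 ∈ frontier U := ⟨hx1, by rwa [hU.interior_eq]⟩
    have h1 := hfr x1 hf
    have h2 : ‖x1‖ ≤ ρ := by simpa using hρ hx1
    have h3 : ‖x1‖ ^ 2 ≤ ρ ^ 2 := by gcongr
    have : 0 ≤ ε * (ρ ^ 2 - ‖x1‖ ^ 2) := mul_nonneg hε0.le (by linarith)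
    simp only [hw] at hw1; linarith
  obtain ⟨R, hR, hRU⟩ := (nhds_basis_closedBall.mem_iff).1 (hU.mem_nhds hx1U)
  have hrep := log_rep hU hu hR hRU
  have hle : ∫ y in ball x1 R, Real.log (R / ‖y - x1‖) * lap u y ≤ 0 := by
    apply setIntegral_nonpos measurableSet_ball
    intro y hy
    refine mul_nonpos_of_nonneg_of_nonpos ?_ (hlap y (hRU (ball_subset_closedBall hy)))
    rcases eq_or_ne y x1 with rfl | hne
    · simp
    · apply Real.log_nonneg
      rw [one_le_div (norm_pos_iff.2 (sub_ne_zero.2 hne))]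
      simpa [dist_eq_norm] using (mem_ball.1 hy).le
  have hpi : -Real.pi ≤ Real.pi := by linarith [Real.pi_pos]
  have hcc : Continuous fun θ : ℝ => x1 + R • cis θ := by have := continuous_cis; fun_prop
  have hci := continuous_inner_cis x1
  have huc : Continuous fun θ : ℝ => u (x1 + R • cis θ) :=
    (hc.mono (hRU.trans subset_closure)).comp_continuous hcc fun θ => polar_mem hR.le le_rfl
  have hge : ∫ θ in (-Real.pi)..Real.pi, (u x1 + ε * R ^ 2 + (2 * ε * R) * inner ℝ x1 (cis θ))
      ≤ ∫ θ in (-Real.pi)..Real.pi, u (x1 + R • cis θ) := by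
    refine intervalIntegral.integral_mono_on hpi ?_ (huc.intervalIntegrable _ _) fun θ _ => ?_
    · apply Continuous.intervalIntegrable; fun_prop
    have h1 : w x1 ≤ w (x1 + R • cis θ) := hmin (subset_closure (hRU (polar_mem hR.le le_rfl)))
    simp only [hw, norm_add_sq_real, norm_smul, norm_cis, inner_smul_right, mul_one, Real.norm_eq_abs,
      sq_abs] at h1
    linarith
  rw [intervalIntegral.integral_add (by simp) (by apply Continuous.intervalIntegrable; fun_prop),
    intervalIntegral.integral_const_mul, integral_inner_cis, intervalIntegral.integral_const] at hge
  have : 0 < 2 * Real.pi * (ε * R ^ 2) := by have := Real.pi_pos; positivity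
  simp only [smul_eq_mul] at hge
  linarith

lemma lap_eq_laplacian {u : ℂ → ℝ} {U : Set ℂ} (hU : IsOpen U) (hu : ContDiffOn ℝ 2 u U) {z : ℂ}
    (hz : z ∈ U) : lap u z = Laplacian.laplacian u z := by
  rw [lap_eq hU hu hz, InnerProductSpace.laplacian_eq_iteratedFDeriv_complexPlane]
  simp [iteratedFDeriv_two_apply]

lemma contDiffOn_log_norm : ContDiffOn ℝ 2 (fun x : ℂ => Real.log ‖x‖) {0}ᶜ :=
  fun _ hx => ((contDiffAt_norm ℝ hx).log (norm_ne_zero_iff.2 hx)).contDiffWithinAt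

lemma lap_add_log_add_sq {u : ℂ → ℝ} {U : Set ℂ} (hU : IsOpen U) (hu : ContDiffOn ℝ 2 u U)
    (h0 : (0 : ℂ) ∉ U) (s p q c : ℝ) {z : ℂ} (hz : z ∈ U) :
    ContDiffOn ℝ 2 (fun x => s * u x + p * Real.log ‖x‖ + q * ‖x‖ ^ 2 + c) U ∧
    lap (fun x => s * u x + p * Real.log ‖x‖ + q * ‖x‖ ^ 2 + c) z = s * lap u z + 4 * q := by
  have hlog : ContDiffOn ℝ 2 (fun x : ℂ => Real.log ‖x‖) U :=
    contDiffOn_log_norm.mono fun x hx => by rintro rfl; exact h0 hx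
  have hsq : ContDiffOn ℝ 2 (fun x : ℂ => ‖x‖ ^ 2) U := (contDiff_norm_sq ℝ).contDiffOn
  have h1 : ContDiffOn ℝ 2 (s • u) U := contDiffOn_const.smul hu
  have h2 : ContDiffOn ℝ 2 (p • fun x : ℂ => Real.log ‖x‖) U := contDiffOn_const.smul hlog
  have h3 : ContDiffOn ℝ 2 (q • fun x : ℂ => ‖x‖ ^ 2) U := contDiffOn_const.smul hsq
  have h4 : ContDiffOn ℝ 2 (fun _ : ℂ => c) U := contDiffOn_const
  have hz0 : z ≠ 0 := by rintro rfl; exact h0 hz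
  have at' : ∀ {g : ℂ → ℝ}, ContDiffOn ℝ 2 g U → ContDiffAt ℝ 2 g z :=
    fun hg => hg.contDiffAt (hU.mem_nhds hz)
  have e : (fun x => s * u x + p * Real.log ‖x‖ + q * ‖x‖ ^ 2 + c)
      = s • u + (p • fun x : ℂ => Real.log ‖x‖) + (q • fun x : ℂ => ‖x‖ ^ 2) + fun _ => c := rfl
  have hA : ContDiffOn ℝ 2 (s • u + p • fun x : ℂ => Real.log ‖x‖) U := h1.add h2
  have hB : ContDiffOn ℝ 2 (s • u + (p • fun x : ℂ => Real.log ‖x‖) + q • fun x : ℂ => ‖x‖ ^ 2) U :=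
    hA.add h3
  have hC : ContDiffOn ℝ 2 (s • u + (p • fun x : ℂ => Real.log ‖x‖) + (q • fun x : ℂ => ‖x‖ ^ 2)
      + fun _ => c) U := hB.add h4
  rw [e]
  refine ⟨hC, ?_⟩
  rw [lap_eq_laplacian hU hC hz, ContDiffAt.laplacian_add (at' hB) (at' h4),
    ContDiffAt.laplacian_add (at' hA) (at' h3), ContDiffAt.laplacian_add (at' h1) (at' h2),
    InnerProductSpace.laplacian_smul _ (at' hu), InnerProductSpace.laplacian_smul _ (at' hlog),
    InnerProductSpace.laplacian_smul _ (at' hsq), ← lap_eq_laplacian hU hu hz]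
  have hl : Laplacian.laplacian (fun x : ℂ => Real.log ‖x‖) z = 0 :=
    (AnalyticAt.harmonicAt_log_norm (analyticAt_id (z := z)) hz0).2.eq_of_nhds
  have hq : Laplacian.laplacian (fun x : ℂ => ‖x‖ ^ 2) z = 4 := by
    rw [← lap_eq_laplacian hU hsq hz, lap_eq hU hsq hz]
    have hf : fderiv ℝ (fun x : ℂ => ‖x‖ ^ 2) = fun x => (2 : ℝ) • innerSL ℝ x := by
      ext1 x
      rw [(hasStrictFDerivAt_norm_sq x).hasFDerivAt.fderiv]
      simp [two_smul]
    have hf2 : fderiv ℝ (fun x : ℂ => (2 : ℝ) • innerSL ℝ x) z = (2 : ℝ) • innerSL ℝ :=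
      ((2 : ℝ) • innerSL ℝ (E := ℂ)).hasFDerivAt.fderiv
    rw [hf, hf2]
    change (2 : ℝ) * inner ℝ (1 : ℂ) 1 + 2 * inner ℝ Complex.I Complex.I = 4
    simp
    norm_num
  have hk : Laplacian.laplacian (fun _ : ℂ => c) z = 0 := by
    rw [InnerProductSpace.laplacian_const]; rfl
  rw [hl, hq, hk]
  simp only [smul_eq_mul]; ring

section

/-- Bounds on the weight `V`. -/
structure IsWeight (V : ℂ → ℝ) (a b K : ℝ) : Prop where
  pos : 0 < a
  lower : ∀ x ∈ closedBall (0 : ℂ) 1, a ≤ V x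
  upper : ∀ x ∈ closedBall (0 : ℂ) 1, V x ≤ b
  cont : ContinuousOn V (closedBall (0 : ℂ) 1)
  c1 : ContDiffOn ℝ 1 V (ball (0 : ℂ) 1)
  deriv : ∀ x ∈ closedBall (0 : ℂ) (1 / 2), ‖fderiv ℝ V x‖ ≤ K

/-- Solutions of the singular Liouville problem with mass at most `C₀`. -/
structure IsSol (V : ℂ → ℝ) (C₀ lam : ℝ) (v : ℂ → ℝ) : Prop where
  lam_pos : 0 < lam
  cont : ContinuousOn v (closedBall (0 : ℂ) 1)
  c2 : ContDiffOn ℝ 2 v (ball (0 : ℂ) 1)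
  pde : ∀ x ∈ ball (0 : ℂ) 1, -lap v x = lam * ‖x‖ ^ 2 * V x * Real.exp (v x)
  bd : ∀ x ∈ sphere (0 : ℂ) 1, v x = 0
  mass : lam * ∫ x in ball (0 : ℂ) 1, ‖x‖ ^ 2 * Real.exp (v x) ≤ C₀

/-- The nonlinearity, extended by zero outside the unit disc. -/
def massDensity (V : ℂ → ℝ) (lam : ℝ) (v : ℂ → ℝ) : ℂ → ℝ :=
  (ball (0 : ℂ) 1).indicator fun x => lam * ‖x‖ ^ 2 * V x * Real.exp (v x)

variable {V v : ℂ → ℝ} {a b K C₀ lam : ℝ}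

lemma IsWeight.upper_pos (hW : IsWeight V a b K) : 0 < b :=
  (hW.pos.trans_le (hW.lower 0 (by simp))).trans_le (hW.upper 0 (by simp))

namespace IsSol

lemma massDensity_eq {x : ℂ} (hx : x ∈ ball (0 : ℂ) 1) :
    massDensity V lam v x = lam * ‖x‖ ^ 2 * V x * Real.exp (v x) := indicator_of_mem hx _

lemma lap_eq_neg (hS : IsSol V C₀ lam v) {x : ℂ} (hx : x ∈ ball (0 : ℂ) 1) :
    lap v x = -massDensity V lam v x := by
  rw [massDensity_eq hx, ← hS.pde x hx, neg_neg]

lemma continuousOn_density (hW : IsWeight V a b K) (hS : IsSol V C₀ lam v) :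
    ContinuousOn (fun x => lam * ‖x‖ ^ 2 * V x * Real.exp (v x)) (closedBall (0 : ℂ) 1) :=
  ((by fun_prop : ContinuousOn (fun x : ℂ => lam * ‖x‖ ^ 2) _).mul hW.cont).mul hS.cont.rexp

lemma continuousOn_massDensity (hW : IsWeight V a b K) (hS : IsSol V C₀ lam v) :
    ContinuousOn (massDensity V lam v) (ball (0 : ℂ) 1) :=
  ((continuousOn_density hW hS).mono ball_subset_closedBall).congr fun _ hx => massDensity_eq hx

lemma massDensity_nonneg (hW : IsWeight V a b K) (hS : IsSol V C₀ lam v) (x : ℂ) :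
    0 ≤ massDensity V lam v x := by
  refine indicator_nonneg (fun x hx => ?_) x
  have h1 := hW.pos.trans_le (hW.lower x (ball_subset_closedBall hx))
  have h2 := hS.lam_pos
  positivity

lemma massDensity_le (hW : IsWeight V a b K) (hS : IsSol V C₀ lam v) {M : ℝ} {x : ℂ}
    (hM : x ∈ ball (0 : ℂ) 1 → v x ≤ M) : massDensity V lam v x ≤ lam * b * Real.exp M := by
  have h2 := hS.lam_pos
  have h3 := hW.upper_pos
  by_cases hx : x ∈ ball (0 : ℂ) 1
  · rw [massDensity_eq hx]
    have hx1 : ‖x‖ < 1 := by simpa using hx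
    have h1 := hW.pos.trans_le (hW.lower x (ball_subset_closedBall hx))
    calc lam * ‖x‖ ^ 2 * V x * Real.exp (v x) ≤ lam * 1 * b * Real.exp M := by
          gcongr
          · exact pow_le_one₀ (norm_nonneg _) hx1.le
          · exact hW.upper x (ball_subset_closedBall hx)
          · exact hM hx
      _ = _ := by ring
  · rw [massDensity, indicator_of_notMem hx]; positivity

lemma integrable_massDensity (hW : IsWeight V a b K) (hS : IsSol V C₀ lam v) :
    Integrable (massDensity V lam v) := by
  rw [massDensity, integrable_indicator_iff measurableSet_ball]
  exact ((continuousOn_density hW hS).integrableOn_compact (isCompact_closedBall _ _)).mono_set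
    ball_subset_closedBall

lemma integral_massDensity_le (hW : IsWeight V a b K) (hS : IsSol V C₀ lam v) :
    ∫ x, massDensity V lam v x ≤ b * C₀ := by
  have hi : IntegrableOn (fun x => ‖x‖ ^ 2 * Real.exp (v x)) (ball (0 : ℂ) 1) :=
    (((by fun_prop : ContinuousOn (fun x : ℂ => ‖x‖ ^ 2) _).mul hS.cont.rexp).integrableOn_compact
      (isCompact_closedBall _ _)).mono_set ball_subset_closedBall
  rw [massDensity, integral_indicator measurableSet_ball]
  calc _ ≤ ∫ x in ball (0 : ℂ) 1, b * (lam * (‖x‖ ^ 2 * Real.exp (v x))) := by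
        apply setIntegral_mono_on ?_ ((hi.const_mul lam).const_mul b) measurableSet_ball
        · intro x hx
          have h2 := hS.lam_pos
          calc lam * ‖x‖ ^ 2 * V x * Real.exp (v x) ≤ lam * ‖x‖ ^ 2 * b * Real.exp (v x) := by
                gcongr; exact hW.upper x (ball_subset_closedBall hx)
            _ = _ := by ring
        · exact ((continuousOn_density hW hS).integrableOn_compact (isCompact_closedBall _ _)).mono_set
            ball_subset_closedBall
    _ = b * (lam * ∫ x in ball (0 : ℂ) 1, ‖x‖ ^ 2 * Real.exp (v x)) := by
        rw [integral_const_mul, integral_const_mul]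
    _ ≤ b * C₀ := by have := hW.upper_pos; gcongr; exact hS.mass

lemma nonneg (hW : IsWeight V a b K) (hS : IsSol V C₀ lam v) :
    ∀ x ∈ closedBall (0 : ℂ) 1, 0 ≤ v x := by
  rw [← closure_ball (0 : ℂ) one_ne_zero]
  refine nonneg_of_lap_nonpos isOpen_ball isBounded_ball hS.c2 ?_ ?_ ?_
  · rw [closure_ball (0 : ℂ) one_ne_zero]; exact hS.cont
  · intro x hx
    rw [hS.lap_eq_neg hx]
    linarith [massDensity_nonneg hW hS x]
  · rw [frontier_ball (0 : ℂ) one_ne_zero]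
    exact fun x hx => (hS.bd x hx).ge

lemma mass_annulus (hS : IsSol V C₀ lam v) {r s c : ℝ} (hr : 0 ≤ r) (hrs : r ≤ s) (hs : s ≤ 1)
    (hc0 : 0 ≤ c) (hc : ∀ x : ℂ, r ≤ ‖x‖ → ‖x‖ < s → c ≤ Real.exp (v x)) :
    lam * (r ^ 2 * c * (Real.pi * (s ^ 2 - r ^ 2))) ≤ C₀ := by
  refine le_trans ?_ hS.mass
  have h0 := hS.lam_pos
  have hi : IntegrableOn (fun x => ‖x‖ ^ 2 * Real.exp (v x)) (ball (0 : ℂ) 1) :=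
    (((by fun_prop : ContinuousOn (fun x : ℂ => ‖x‖ ^ 2) _).mul hS.cont.rexp).integrableOn_compact
      (isCompact_closedBall _ _)).mono_set ball_subset_closedBall
  have hsub : ball (0 : ℂ) s \ ball 0 r ⊆ ball 0 1 := sdiff_subset.trans (ball_subset_ball hs)
  gcongr
  calc r ^ 2 * c * (Real.pi * (s ^ 2 - r ^ 2))
      = ∫ x in ball (0 : ℂ) s \ ball 0 r, r ^ 2 * c := by
        rw [setIntegral_const, measureReal_sdiff (ball_subset_ball hrs) measurableSet_ball
          measure_ball_lt_top.ne, smul_eq_mul, measureReal_def, measureReal_def, Complex.volume_ball,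
          Complex.volume_ball]
        simp [hr, hr.trans hrs]
        ring
    _ ≤ ∫ x in ball (0 : ℂ) s \ ball 0 r, ‖x‖ ^ 2 * Real.exp (v x) := by
        refine setIntegral_mono_on ?_ (hi.mono_set hsub) (measurableSet_ball.diff measurableSet_ball) ?_
        · exact integrableOn_const ((measure_mono hsub).trans_lt measure_ball_lt_top).ne
        · intro x hx
          have h1 : r ≤ ‖x‖ := by simpa using hx.2
          have h2 : ‖x‖ < s := by simpa using hx.1
          gcongr
          exact hc x h1 h2
    _ ≤ _ := by
        refine setIntegral_mono_set hi (Eventually.of_forall fun x => by positivity)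
          (Eventually.of_forall hsub)

lemma lam_le (hW : IsWeight V a b K) (hS : IsSol V C₀ lam v) : lam ≤ 2 * C₀ := by
  have h := hS.mass_annulus (r := 1 / 2) (s := 1) (c := 1) (by norm_num) (by norm_num) le_rfl
    (by norm_num) fun x _ hx => Real.one_le_exp (hS.nonneg hW x (by simpa using hx.le))
  have h1 := Real.pi_gt_three
  have := hS.lam_pos
  nlinarith

/-- Representation of the solution at the centre of a disc. -/
lemma rep (hS : IsSol V C₀ lam v) {x : ℂ} {R : ℝ} (hR : 0 < R) (hx : closedBall x R ⊆ ball 0 1) :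
    2 * Real.pi * v x = (∫ θ in (-Real.pi)..Real.pi, v (x + R • cis θ))
      + ∫ y in ball x R, Real.log (R / ‖y - x‖) * massDensity V lam v y := by
  have h := log_rep isOpen_ball hS.c2 hR hx
  have e : ∫ y in ball x R, Real.log (R / ‖y - x‖) * lap v y
      = - ∫ y in ball x R, Real.log (R / ‖y - x‖) * massDensity V lam v y := by
    rw [← integral_neg]
    refine setIntegral_congr_fun measurableSet_ball fun y hy => ?_
    simp only [hS.lap_eq_neg (hx (ball_subset_closedBall hy))]
    ring
  linarith

lemma integrableOn_rep (hW : IsWeight V a b K) (hS : IsSol V C₀ lam v) {x : ℂ} {R : ℝ} (hR : 0 < R)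
    (hx : closedBall x R ⊆ ball 0 1) :
    IntegrableOn (fun y => Real.log (R / ‖y - x‖) * massDensity V lam v y) (ball x R) :=
  (integrableOn_log_mul hR ((continuousOn_massDensity hW hS).mono hx)).1

lemma fderiv_rep (hS : IsSol V C₀ lam v) {x : ℂ} {R : ℝ} (hR : 0 < R)
    (hx : closedBall x R ⊆ ball 0 1) (w : ℂ) :
    2 * Real.pi * fderiv ℝ v x w
      = 2 / R * (∫ θ in (-Real.pi)..Real.pi, v (x + R • cis θ) * inner ℝ w (cis θ))
      + ∫ y in ball x R, inner ℝ w (y - x) * ((‖y - x‖ ^ 2)⁻¹ - (R ^ 2)⁻¹) * massDensity V lam v y := by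
  have h := grad_rep isOpen_ball hS.c2 hR hx w
  have e : ∫ y in ball x R, inner ℝ w (y - x) * ((‖y - x‖ ^ 2)⁻¹ - (R ^ 2)⁻¹) * lap v y
      = - ∫ y in ball x R, inner ℝ w (y - x) * ((‖y - x‖ ^ 2)⁻¹ - (R ^ 2)⁻¹)
        * massDensity V lam v y := by
    rw [← integral_neg]
    refine setIntegral_congr_fun measurableSet_ball fun y hy => ?_
    simp only [hS.lap_eq_neg (hx (ball_subset_closedBall hy))]
    ring
  linarith

end IsSol

end

section

variable {V v : ℂ → ℝ} {a b K C₀ lam : ℝ}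

lemma norm_le_of_mem_half {x y : ℂ} (hx : ‖x‖ ≤ 1 / 4) (hy : y ∈ closedBall x (1 / 2)) :
    ‖y‖ ≤ 3 / 4 := by
  have h1 : ‖y - x‖ ≤ 1 / 2 := by simpa [dist_eq_norm] using hy
  have h2 := norm_sub_norm_le y x
  linarith

lemma closedBall_half_subset {x : ℂ} (hx : ‖x‖ ≤ 1 / 4) : closedBall x (1 / 2) ⊆ ball (0 : ℂ) 1 :=
  fun y hy => by
    have := norm_le_of_mem_half hx hy
    rw [mem_ball_zero_iff]; linarith

lemma norm_circle_half {x : ℂ} (hx : ‖x‖ ≤ 1 / 4) (θ : ℝ) :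
    1 / 4 ≤ ‖x + (1 / 2 : ℝ) • cis θ‖ ∧ ‖x + (1 / 2 : ℝ) • cis θ‖ ≤ 1 := by
  have h1 := norm_add_le x ((1 / 2 : ℝ) • cis θ)
  have h2 := norm_sub_norm_le ((1 / 2 : ℝ) • cis θ) (-x)
  rw [norm_neg, sub_neg_eq_add, add_comm ((1 / 2 : ℝ) • cis θ)] at h2
  rw [norm_smul, norm_cis, Real.norm_of_nonneg (by norm_num)] at h1 h2
  constructor <;> linarith

namespace IsSol

lemma circle_half_bounds (hW : IsWeight V a b K) (hS : IsSol V C₀ lam v) {C x} (hx : ‖x‖ ≤ 1 / 4)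
    (hC : ∀ x : ℂ, 1 / 4 ≤ ‖x‖ → ‖x‖ ≤ 1 → v x ≤ C) (θ : ℝ) :
    0 ≤ v (x + (1 / 2 : ℝ) • cis θ) ∧ v (x + (1 / 2 : ℝ) • cis θ) ≤ C :=
  ⟨hS.nonneg hW _ (by simpa using (norm_circle_half hx θ).2), hC _ (norm_circle_half hx θ).1
    (norm_circle_half hx θ).2⟩

lemma continuous_circle_half (hS : IsSol V C₀ lam v) {x : ℂ} (hx : ‖x‖ ≤ 1 / 4) :
    Continuous fun θ : ℝ => v (x + (1 / 2 : ℝ) • cis θ) := by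
  refine hS.cont.comp_continuous ?_ fun θ => by simpa using (norm_circle_half hx θ).2
  have := continuous_cis; fun_prop

lemma rep_bounds (hW : IsWeight V a b K) (hS : IsSol V C₀ lam v) {C x} (hx : ‖x‖ ≤ 1 / 4)
    (hC : ∀ x : ℂ, 1 / 4 ≤ ‖x‖ → ‖x‖ ≤ 1 → v x ≤ C) :
    ∫ y in ball x (1 / 2), Real.log (1 / 2 / ‖y - x‖) * massDensity V lam v y ≤ 2 * Real.pi * v x ∧
    2 * Real.pi * v x ≤ 2 * Real.pi * C
      + ∫ y in ball x (1 / 2), Real.log (1 / 2 / ‖y - x‖) * massDensity V lam v y := by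
  rw [hS.rep (by norm_num) (closedBall_half_subset hx)]
  have hpi : -Real.pi ≤ Real.pi := by linarith [Real.pi_pos]
  have h1 : 0 ≤ ∫ θ in (-Real.pi)..Real.pi, v (x + (1 / 2 : ℝ) • cis θ) :=
    intervalIntegral.integral_nonneg hpi fun θ _ => (circle_half_bounds hW hS hx hC θ).1
  have h2 : ∫ θ in (-Real.pi)..Real.pi, v (x + (1 / 2 : ℝ) • cis θ)
      ≤ ∫ θ in (-Real.pi)..Real.pi, C :=
    intervalIntegral.integral_mono_on hpi ((hS.continuous_circle_half hx).intervalIntegrable _ _)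
      (by simp) fun θ _ => (circle_half_bounds hW hS hx hC θ).2
  rw [intervalIntegral.integral_const, smul_eq_mul] at h2
  constructor <;> linarith

/-- If the maximum of the solution is attained near the origin, it controls the mass there. -/
lemma max_le (hW : IsWeight V a b K) (hS : IsSol V C₀ lam v) {ρ C M : ℝ} {x0 : ℂ} (hρ0 : 0 < ρ)
    (hρ : ρ ≤ 1 / 4) (hC : ∀ x : ℂ, 1 / 4 ≤ ‖x‖ → ‖x‖ ≤ 1 → v x ≤ C)
    (hM : ∀ x ∈ closedBall (0 : ℂ) 1, v x ≤ M) (hx0 : ‖x0‖ < ρ / 2) (hx0M : v x0 = M) :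
    2 * Real.pi * M ≤ 2 * Real.pi * C + Real.log (1 / ρ) * (b * C₀)
      + M / 2 * (∫ y in ball (0 : ℂ) ρ, massDensity V lam v y) + 4 * Real.pi * (b * C₀) := by
  set F := massDensity V lam v with hF
  have hx4 : ‖x0‖ ≤ 1 / 4 := by linarith
  have hF0 : ∀ y, 0 ≤ F y := massDensity_nonneg hW hS
  have hFi : Integrable F := integrable_massDensity hW hS
  have hM0 : 0 ≤ M := hx0M ▸ hS.nonneg hW x0 (by rw [mem_closedBall_zero_iff]; linarith)
  set t := Real.exp (-(M / 2)) with ht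
  have ht0 : 0 < t := Real.exp_pos _
  have hL : 0 ≤ Real.log (1 / ρ) := Real.log_nonneg (by rw [one_le_div hρ0]; linarith)
  have hlam := hS.lam_pos
  have hb := hW.upper_pos
  have hFΛ : ∀ y, F y ≤ lam * b * Real.exp M := fun y =>
    massDensity_le hW hS fun hy => hM y (ball_subset_closedBall hy)
  set G : ℂ → ℝ := fun y => Real.log (1 / ρ) * F y + M / 2 * (ball (0 : ℂ) ρ).indicator F y
    + lam * b * Real.exp M * t * (ball x0 t).indicator (fun y => ‖y - x0‖⁻¹) y with hG
  have hi2 : Integrable ((ball (0 : ℂ) ρ).indicator F) := hFi.indicator measurableSet_ball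
  have hi3 : Integrable ((ball x0 t).indicator (fun y : ℂ => ‖y - x0‖⁻¹)) :=
    (integrable_indicator_iff measurableSet_ball).2 (integrableOn_inv_dist x0 t)
  have hi12 : Integrable (fun y => Real.log (1 / ρ) * F y
      + M / 2 * (ball (0 : ℂ) ρ).indicator F y) :=
    (hFi.const_mul (Real.log (1 / ρ))).add (hi2.const_mul (M / 2))
  have hi3' := hi3.const_mul (lam * b * Real.exp M * t)
  have hGi : Integrable G := hi12.add hi3'
  have hG0 : ∀ y, 0 ≤ G y := fun y => by
    have h1 : 0 ≤ (ball (0 : ℂ) ρ).indicator F y := indicator_nonneg (fun y _ => hF0 y) y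
    have h2 : 0 ≤ (ball x0 t).indicator (fun y : ℂ => ‖y - x0‖⁻¹) y :=
      indicator_nonneg (fun y _ => by positivity) y
    have h3 := hF0 y
    simp only [hG]
    positivity
  have hpt : ∀ y ∈ ball x0 (1 / 2), Real.log (1 / 2 / ‖y - x0‖) * F y ≤ G y := by
    intro y _
    rcases eq_or_ne y x0 with rfl | hne
    · simpa using hG0 y
    have hs : 0 < ‖y - x0‖ := norm_pos_iff.2 (sub_ne_zero.2 hne)
    have h3 := hF0 y
    by_cases hyρ : ‖y‖ < ρ
    · have hyρ' : y ∈ ball (0 : ℂ) ρ := by simpa using hyρ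
      by_cases hst : ‖y - x0‖ < t
      · have hst' : y ∈ ball x0 t := by simpa [dist_eq_norm] using hst
        have h1 : Real.log (1 / 2 / ‖y - x0‖) ≤ M / 2 + t * ‖y - x0‖⁻¹ := by
          have h2 : Real.log (1 / 2 / ‖y - x0‖) ≤ Real.log (t⁻¹ * (t * ‖y - x0‖⁻¹)) := by
            apply Real.log_le_log (by positivity)
            rw [inv_mul_cancel_left₀ ht0.ne', div_eq_mul_inv]
            have : 0 < ‖y - x0‖⁻¹ := by positivity
            linarith
          rw [Real.log_mul (by positivity) (by positivity), Real.log_inv, ht, Real.log_exp] at h2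
          have h4 := Real.log_le_sub_one_of_pos (x := t * ‖y - x0‖⁻¹) (by positivity)
          linarith
        simp only [hG, indicator_of_mem hyρ', indicator_of_mem hst']
        have h5 : (t * ‖y - x0‖⁻¹) * F y ≤ (t * ‖y - x0‖⁻¹) * (lam * b * Real.exp M) := by
          gcongr; exact hFΛ y
        have h6 := mul_le_mul_of_nonneg_right h1 h3
        have h7 : 0 ≤ Real.log (1 / ρ) * F y := by positivity
        linarith
      · have hst' : y ∉ ball x0 t := by simpa [dist_eq_norm] using hst
        have h1 : Real.log (1 / 2 / ‖y - x0‖) ≤ M / 2 := by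
          have h2 : Real.log (1 / 2 / ‖y - x0‖) ≤ Real.log (t⁻¹) := by
            apply Real.log_le_log (by positivity)
            rw [div_eq_mul_inv]
            have h8 : ‖y - x0‖⁻¹ ≤ t⁻¹ := by gcongr; exact not_lt.1 hst
            have : 0 < ‖y - x0‖⁻¹ := by positivity
            linarith
          rwa [Real.log_inv, ht, Real.log_exp, neg_neg] at h2
        simp only [hG, indicator_of_mem hyρ', indicator_of_notMem hst']
        have h6 := mul_le_mul_of_nonneg_right h1 h3
        have h7 : 0 ≤ Real.log (1 / ρ) * F y := by positivity
        linarith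
    · have h1 : Real.log (1 / 2 / ‖y - x0‖) ≤ Real.log (1 / ρ) := by
        apply Real.log_le_log (by positivity)
        rw [div_div, div_le_div_iff_of_pos_left one_pos (by positivity) hρ0]
        have := norm_sub_norm_le y x0
        linarith [not_lt.1 hyρ]
      have h2 : 0 ≤ (ball x0 t).indicator (fun y : ℂ => ‖y - x0‖⁻¹) y :=
        indicator_nonneg (fun y _ => by positivity) y
      have hyρ' : y ∉ ball (0 : ℂ) ρ := by simpa using hyρ
      have h6 := mul_le_mul_of_nonneg_right h1 h3
      simp only [hG, indicator_of_notMem hyρ']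
      have h7 : 0 ≤ lam * b * Real.exp M * t * (ball x0 t).indicator (fun y : ℂ => ‖y - x0‖⁻¹) y := by
        positivity
      linarith
  have h1 := (rep_bounds hW hS hx4 hC).2
  have h2 : ∫ y in ball x0 (1 / 2), Real.log (1 / 2 / ‖y - x0‖) * F y ≤ ∫ y, G y :=
    (setIntegral_mono_on (integrableOn_rep hW hS (by norm_num) (closedBall_half_subset hx4))
      hGi.integrableOn measurableSet_ball hpt).trans
      (setIntegral_le_integral hGi (Eventually.of_forall hG0))
  have h3 : ∫ y, G y = Real.log (1 / ρ) * (∫ y, F y) + M / 2 * (∫ y in ball (0 : ℂ) ρ, F y)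
      + 2 * Real.pi * (lam * b) := by
    rw [hG, integral_add hi12 hi3', integral_const_mul,
      integral_indicator measurableSet_ball, integral_inv_dist x0 ht0.le]
    have e0 := integral_add (hFi.const_mul (Real.log (1 / ρ))) (hi2.const_mul (M / 2))
    rw [integral_const_mul, integral_const_mul, integral_indicator measurableSet_ball] at e0
    have e1 : Real.exp M * t * t = 1 := by
      rw [ht, ← Real.exp_add, ← Real.exp_add, Real.exp_eq_one_iff]; ring
    rw [e0]
    linear_combination (2 * Real.pi * lam * b) * e1
  have h4 : Real.log (1 / ρ) * (∫ y, F y) ≤ Real.log (1 / ρ) * (b * C₀) := by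
    gcongr; exact integral_massDensity_le hW hS
  have h5 : 2 * Real.pi * (lam * b) ≤ 4 * Real.pi * (b * C₀) := by
    have := hS.lam_le hW
    have h6 : lam * b ≤ 2 * C₀ * b := by gcongr
    nlinarith [Real.pi_pos]
  rw [h3] at h2
  rw [hx0M, ← hF] at h1
  linarith

end IsSol

end

section

variable {V v : ℂ → ℝ} {a b K C₀ lam : ℝ}

namespace IsSol

/-- Radial integration by parts against the cutoff `1 - ‖x‖² / ε²`. -/
lemma pohozaev (hW : IsWeight V a b K) (hS : IsSol V C₀ lam v) {ε : ℝ} (hε : 0 < ε) (hε1 : ε < 1) :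
    ∫ x in ball (0 : ℂ) ε, lam * ‖x‖ ^ 2 * Real.exp (v x) * (V x * (-2 * ‖x‖ ^ 2 / ε ^ 2
      + (1 - ‖x‖ ^ 2 / ε ^ 2) * (4 + fderiv ℝ v x x)) + (1 - ‖x‖ ^ 2 / ε ^ 2) * fderiv ℝ V x x) = 0 := by
  have hsub : closedBall (0 : ℂ) ε ⊆ ball 0 1 := closedBall_subset_ball hε1
  have hdV : ContinuousOn (fderiv ℝ V) (closedBall (0 : ℂ) ε) :=
    (hW.c1.continuousOn_fderiv_of_isOpen isOpen_ball le_rfl).mono hsub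
  have hdv : ContinuousOn (fderiv ℝ v) (closedBall (0 : ℂ) ε) :=
    (hS.c2.continuousOn_fderiv_of_isOpen isOpen_ball (by norm_num)).mono hsub
  have hVc := hW.cont.mono (hsub.trans ball_subset_closedBall)
  have hvc := hS.cont.mono (hsub.trans ball_subset_closedBall)
  set h : ℂ → ℝ := fun x => lam * ‖x‖ ^ 2 * Real.exp (v x) * (V x * (-2 * ‖x‖ ^ 2 / ε ^ 2
      + (1 - ‖x‖ ^ 2 / ε ^ 2) * (4 + fderiv ℝ v x x)) + (1 - ‖x‖ ^ 2 / ε ^ 2) * fderiv ℝ V x x) with hh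
  have hc : ContinuousOn h (closedBall (0 : ℂ) ε) := by
    have h1 : ContinuousOn (fun x => fderiv ℝ V x x) (closedBall (0 : ℂ) ε) :=
      hdV.clm_apply continuousOn_id
    have h2 : ContinuousOn (fun x => fderiv ℝ v x x) (closedBall (0 : ℂ) ε) :=
      hdv.clm_apply continuousOn_id
    have h3 := hvc.rexp
    fun_prop
  have e1 : ∫ x in ball (0 : ℂ) ε, h x = ∫ x in ball (0 : ℂ) ε \ closedBall 0 0, h x := by
    rw [closedBall_zero]
    exact setIntegral_congr_set (sdiff_null_ae_eq_self (by simp)).symm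
  have hpi : -Real.pi ≤ Real.pi := by linarith [Real.pi_pos]
  rw [e1, integral_annulus_polar le_rfl hε.le (hc.mono sdiff_subset)]
  have hc2 : ContinuousOn (fun p : ℝ × ℝ => p.1 * h (0 + p.1 • cis p.2))
      (Icc 0 ε ×ˢ univ) := by
    apply continuousOn_fst.mul
    apply hc.comp (continuous_polar 0).continuousOn
    rintro p ⟨hp, -⟩
    exact polar_mem hp.1 hp.2
  have hswap : ∫ r in (0:ℝ)..ε, ∫ θ in (-Real.pi)..Real.pi, r * h (0 + r • cis θ)
      = ∫ θ in (-Real.pi)..Real.pi, ∫ r in (0:ℝ)..ε, r * h (0 + r • cis θ) := by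
    rw [intervalIntegral.integral_of_le hpi]
    simp_rw [intervalIntegral.integral_of_le hpi]
    apply intervalIntegral_integral_swap
    rw [uIoc_of_le hε.le, Measure.prod_restrict]
    exact ((hc2.mono (prod_mono_right (subset_univ _))).integrableOn_compact
      (isCompact_Icc.prod isCompact_Icc)).mono_set
      (prod_mono Ioc_subset_Icc_self Ioc_subset_Icc_self)
  rw [hswap]
  have hin : ∀ θ : ℝ, ∫ r in (0:ℝ)..ε, r * h (0 + r • cis θ) = 0 := by
    intro θ
    have hd : ∀ r ∈ uIcc 0 ε, HasDerivAt (fun r : ℝ => (1 - r ^ 2 / ε ^ 2) * r ^ 2 *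
        (lam * r ^ 2 * V (0 + r • cis θ) * Real.exp (v (0 + r • cis θ)))) (r * h (0 + r • cis θ)) r := by
      intro r hr
      rw [uIcc_of_le hε.le] at hr
      have hmem : (0 : ℂ) + r • cis θ ∈ ball (0 : ℂ) 1 := hsub (polar_mem hr.1 hr.2)
      have hV' := ((hW.c1.contDiffAt (isOpen_ball.mem_nhds hmem)).differentiableAt
        (by norm_num)).hasFDerivAt.comp_hasDerivAt r (hasDerivAt_polar_r 0 r θ)
      have hv' := (hasFDerivAt_of_mem isOpen_ball hS.c2 hmem).comp_hasDerivAt r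
        (hasDerivAt_polar_r 0 r θ)
      have hp := (((hasDerivAt_pow 2 r).div_const (ε ^ 2)).const_sub 1).mul (hasDerivAt_pow 2 r)
      have hq := (((hasDerivAt_pow 2 r).const_mul lam).mul hV').mul hv'.exp
      refine HasDerivAt.congr_deriv (hp.mul hq) ?_
      simp only [hh, Function.comp, Pi.mul_apply, zero_add, norm_smul, norm_cis, mul_one,
        Real.norm_of_nonneg hr.1, map_smul, smul_eq_mul]
      field_simp
      ring
    rw [intervalIntegral.integral_eq_sub_of_hasDerivAt hd]
    · field_simp; simp
    · apply ContinuousOn.intervalIntegrable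
      rw [uIcc_of_le hε.le]
      exact hc2.comp (f := fun r : ℝ => (r, θ)) (by fun_prop) fun r hr => ⟨hr, mem_univ _⟩
  simp_rw [hin]
  simp

end IsSol

end

/-- The gradient kernel in the radial direction, cut off outside the disc of radius `ε`. -/
def cutoffKernel (ε : ℝ) (x y : ℂ) : ℝ :=
  (ball (0 : ℂ) ε).indicator (fun x => 1 - ‖x‖ ^ 2 / ε ^ 2) x * (inner ℝ x (x - y) / ‖x - y‖ ^ 2)

lemma measurable_cutoffKernel (ε : ℝ) :
    Measurable fun p : ℂ × ℂ => cutoffKernel ε p.1 p.2 := by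
  unfold cutoffKernel
  have h : Measurable ((ball (0 : ℂ) ε).indicator fun x : ℂ => 1 - ‖x‖ ^ 2 / ε ^ 2) :=
    (by fun_prop : Measurable fun x : ℂ => 1 - ‖x‖ ^ 2 / ε ^ 2).indicator measurableSet_ball
  refine (h.comp measurable_fst).mul (Measurable.div ?_ (by fun_prop))
  exact (by fun_prop : Continuous fun p : ℂ × ℂ => (inner ℝ p.1 (p.1 - p.2) : ℝ)).measurable

lemma abs_inner_div_le (w z : ℂ) : |(inner ℝ w z : ℝ) / ‖z‖ ^ 2| ≤ ‖w‖ * ‖z‖⁻¹ := by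
  rcases eq_or_ne z 0 with rfl | hz
  · simp
  have hz' : 0 < ‖z‖ := norm_pos_iff.2 hz
  rw [abs_div, abs_of_pos (pow_pos hz' 2), div_le_iff₀ (pow_pos hz' 2)]
  calc |(inner ℝ w z : ℝ)| ≤ ‖w‖ * ‖z‖ := abs_real_inner_le_norm w z
    _ = _ := by field_simp

lemma cutoffKernel_of_notMem {ε : ℝ} {x : ℂ} (hx : x ∉ ball (0 : ℂ) ε) (y : ℂ) :
    cutoffKernel ε x y = 0 := by
  simp only [cutoffKernel, indicator_of_notMem hx, zero_mul]

lemma abs_cutoffKernel_le {ε : ℝ} (hε : 0 < ε) (x y : ℂ) :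
    |cutoffKernel ε x y| ≤ ε * ‖x - y‖⁻¹ := by
  by_cases hx : x ∈ ball (0 : ℂ) ε
  · have hx' : ‖x‖ < ε := by simpa using hx
    have h2 : ‖x‖ ^ 2 / ε ^ 2 ≤ 1 := by
      rw [div_le_one (by positivity)]; gcongr
    have h3 : 0 ≤ ‖x‖ ^ 2 / ε ^ 2 := by positivity
    rw [cutoffKernel, indicator_of_mem hx, abs_mul]
    calc _ ≤ 1 * (‖x‖ * ‖x - y‖⁻¹) := by
          gcongr
          · rw [abs_le]; constructor <;> linarith
          · exact abs_inner_div_le _ _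
      _ ≤ _ := by rw [one_mul]; gcongr
  · rw [cutoffKernel_of_notMem hx, abs_zero]; positivity

lemma norm_cube_sub_le (x y : ℂ) :
    ‖(‖x‖ ^ 2) • x - (‖y‖ ^ 2) • y‖ ≤ ‖x - y‖ * (3 / 2 * (‖x‖ ^ 2 + ‖y‖ ^ 2)) := by
  have e : (‖x‖ ^ 2) • x - (‖y‖ ^ 2) • y
      = (‖x‖ ^ 2) • (x - y) + ((‖x‖ - ‖y‖) * (‖x‖ + ‖y‖)) • y := by
    simp only [Complex.real_smul]; push_cast; ring
  have h1 := abs_norm_sub_norm_le x y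
  have h2 := norm_nonneg x
  have h3 := norm_nonneg y
  have h4 := norm_nonneg (x - y)
  rw [e]
  calc _ ≤ ‖(‖x‖ ^ 2) • (x - y)‖ + ‖((‖x‖ - ‖y‖) * (‖x‖ + ‖y‖)) • y‖ := norm_add_le _ _
    _ = ‖x‖ ^ 2 * ‖x - y‖ + |‖x‖ - ‖y‖| * (‖x‖ + ‖y‖) * ‖y‖ := by
        rw [norm_smul, norm_smul, norm_mul, Real.norm_of_nonneg (by positivity : 0 ≤ ‖x‖ ^ 2),
          Real.norm_of_nonneg (by positivity : 0 ≤ ‖x‖ + ‖y‖), Real.norm_eq_abs]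
    _ ≤ ‖x‖ ^ 2 * ‖x - y‖ + ‖x - y‖ * (‖x‖ + ‖y‖) * ‖y‖ := by gcongr
    _ = ‖x - y‖ * (‖x‖ ^ 2 + (‖x‖ + ‖y‖) * ‖y‖) := by ring
    _ ≤ _ := by gcongr; nlinarith [sq_nonneg (‖x‖ - ‖y‖)]

lemma abs_cutoffKernel_le_of_notMem {ε : ℝ} (hε : 0 < ε) {x y : ℂ} (hx : x ∈ ball (0 : ℂ) ε)
    (hy : y ∉ ball (0 : ℂ) ε) : |cutoffKernel ε x y| ≤ 2 * (‖x‖ / ε) := by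
  have hx' : ‖x‖ < ε := by simpa using hx
  have hy' : ε ≤ ‖y‖ := by simpa using hy
  have h1 : ε - ‖x‖ ≤ ‖x - y‖ := by
    have := norm_sub_norm_le y x
    rw [norm_sub_rev] at this; linarith
  have h2 : 0 < ‖x - y‖ := by linarith
  have h0 := norm_nonneg x
  have e : 1 - ‖x‖ ^ 2 / ε ^ 2 = (ε - ‖x‖) * (ε + ‖x‖) / ε ^ 2 := by field_simp; ring
  rw [cutoffKernel, indicator_of_mem hx, abs_mul]
  have h3 : |1 - ‖x‖ ^ 2 / ε ^ 2| ≤ ‖x - y‖ * (2 * ε) / ε ^ 2 := by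
    rw [e, abs_of_nonneg (div_nonneg (mul_nonneg (by linarith) (by linarith)) (by positivity))]
    gcongr
    linarith
  calc _ ≤ ‖x - y‖ * (2 * ε) / ε ^ 2 * (‖x‖ * ‖x - y‖⁻¹) := by
        gcongr; exact abs_inner_div_le _ _
    _ = _ := by field_simp

lemma cutoffKernel_add_swap {ε : ℝ} (hε : 0 < ε) {x y : ℂ} (hxy : x ≠ y) :
    |cutoffKernel ε x y + cutoffKernel ε y x
      - (ball (0 : ℂ) ε).indicator 1 x * (ball (0 : ℂ) ε).indicator 1 y|
    ≤ 3 * ((ball (0 : ℂ) ε).indicator (fun x => ‖x‖ / ε) x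
      + (ball (0 : ℂ) ε).indicator (fun x => ‖x‖ / ε) y) := by
  by_cases hx : x ∈ ball (0 : ℂ) ε <;> by_cases hy : y ∈ ball (0 : ℂ) ε
  · have hx' : ‖x‖ < ε := by simpa using hx
    have hy' : ‖y‖ < ε := by simpa using hy
    have hd : 0 < ‖x - y‖ := norm_pos_iff.2 (sub_ne_zero.2 hxy)
    simp only [cutoffKernel, indicator_of_mem hx, indicator_of_mem hy, Pi.one_apply, mul_one]
    have e : (1 - ‖x‖ ^ 2 / ε ^ 2) * ((inner ℝ x (x - y) : ℝ) / ‖x - y‖ ^ 2)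
        + (1 - ‖y‖ ^ 2 / ε ^ 2) * ((inner ℝ y (y - x) : ℝ) / ‖y - x‖ ^ 2) - 1
        = -((inner ℝ ((‖x‖ ^ 2) • x - (‖y‖ ^ 2) • y) (x - y) : ℝ) / ‖x - y‖ ^ 2) / ε ^ 2 := by
      have h1 : (inner ℝ y (y - x) : ℝ) = - inner ℝ y (x - y) := by
        rw [← inner_neg_right, neg_sub]
      have h2 : (inner ℝ x (x - y) : ℝ) - inner ℝ y (x - y) = ‖x - y‖ ^ 2 := by
        rw [← inner_sub_left, real_inner_self_eq_norm_sq]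
      rw [norm_sub_rev y x, h1, inner_sub_left, real_inner_smul_left, real_inner_smul_left]
      field_simp
      linear_combination ε ^ 2 * h2
    rw [e, abs_div, abs_neg, abs_of_pos (by positivity : 0 < ε ^ 2)]
    calc _ ≤ (‖x - y‖ * (3 / 2 * (‖x‖ ^ 2 + ‖y‖ ^ 2)) * ‖x - y‖⁻¹) / ε ^ 2 := by
          gcongr
          exact (abs_inner_div_le _ _).trans (by gcongr; exact norm_cube_sub_le x y)
      _ = 3 / 2 * ((‖x‖ / ε) ^ 2 + (‖y‖ / ε) ^ 2) := by field_simp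
      _ ≤ 3 * ((‖x‖ / ε) ^ 1 + (‖y‖ / ε) ^ 1) := by
          gcongr ?_ * (?_ + ?_)
          · norm_num
          · exact pow_le_pow_of_le_one (by positivity) (by rw [div_le_one hε]; exact hx'.le)
              (by norm_num)
          · exact pow_le_pow_of_le_one (by positivity) (by rw [div_le_one hε]; exact hy'.le)
              (by norm_num)
      _ = _ := by simp
  · have h := abs_cutoffKernel_le_of_notMem hε hx hy
    rw [cutoffKernel_of_notMem hy, indicator_of_notMem hy, indicator_of_notMem hy,
      indicator_of_mem hx (fun x : ℂ => ‖x‖ / ε)]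
    have : 0 ≤ ‖x‖ / ε := by positivity
    simp only [mul_zero, sub_zero, add_zero]
    linarith
  · have h := abs_cutoffKernel_le_of_notMem hε hy hx
    rw [cutoffKernel_of_notMem hx, indicator_of_notMem hx, indicator_of_notMem hx,
      indicator_of_mem hy (fun x : ℂ => ‖x‖ / ε)]
    have : 0 ≤ ‖y‖ / ε := by positivity
    simp only [zero_mul, sub_zero, zero_add]
    linarith
  · rw [cutoffKernel_of_notMem hx, cutoffKernel_of_notMem hy, indicator_of_notMem hx,
      indicator_of_notMem hx, indicator_of_notMem hy, indicator_of_notMem hy]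
    simp

section

variable {F : ℂ → ℝ} {Λ ε : ℝ}

lemma integrable_mul_cutoffKernel (hF : Integrable F) (hF0 : ∀ x, 0 ≤ F x) (hΛ : ∀ x, F x ≤ Λ)
    (hsupp : ∀ x, x ∉ ball (0 : ℂ) 1 → F x = 0) (hε : 0 < ε) :
    Integrable (fun p : ℂ × ℂ => F p.1 * F p.2 * cutoffKernel ε p.1 p.2)
      (volume.prod volume) := by
  have hg : Integrable ((ball (0 : ℂ) 2).indicator fun y : ℂ => ‖y - 0‖⁻¹) :=
    (integrable_indicator_iff measurableSet_ball).2 (integrableOn_inv_dist 0 2)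
  have hconv := (hF.convolution_integrand (ContinuousLinearMap.mul ℝ ℝ) hg).const_mul (Λ * ε)
  have hΛ0 : 0 ≤ Λ := (hF0 0).trans (hΛ 0)
  refine hconv.mono ?_ (Eventually.of_forall fun p => ?_)
  · exact (hF.1.comp_fst.mul hF.1.comp_snd).mul (measurable_cutoffKernel ε).aestronglyMeasurable
  · have hnn : 0 ≤ (ball (0 : ℂ) 2).indicator (fun y : ℂ => ‖y - 0‖⁻¹) (p.1 - p.2) :=
      indicator_nonneg (fun _ _ => by positivity) _
    simp only [ContinuousLinearMap.mul_apply']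
    rw [Real.norm_of_nonneg (mul_nonneg (by positivity) (mul_nonneg (hF0 _) hnn))]
    by_cases h1 : p.1 ∈ ball (0 : ℂ) 1
    · by_cases h2 : p.2 ∈ ball (0 : ℂ) 1
      · have hm : p.1 - p.2 ∈ ball (0 : ℂ) 2 := by
          simp only [mem_ball_zero_iff] at h1 h2 ⊢
          linarith [norm_sub_le p.1 p.2]
        rw [indicator_of_mem hm, sub_zero, norm_mul, norm_mul, Real.norm_of_nonneg (hF0 _),
          Real.norm_of_nonneg (hF0 _), Real.norm_eq_abs]
        have := hF0 p.2
        calc _ ≤ Λ * F p.2 * (ε * ‖p.1 - p.2‖⁻¹) := by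
              gcongr
              · exact hΛ _
              · exact abs_cutoffKernel_le hε _ _
          _ = _ := by ring
      · rw [hsupp _ h2]; simp
    · rw [hsupp _ h1]
      have := hF0 p.2
      simp only [zero_mul, norm_zero]; positivity

lemma abs_integral_cutoffKernel_sub_le (hF : Integrable F) (hF0 : ∀ x, 0 ≤ F x) (hΛ : ∀ x, F x ≤ Λ)
    (hsupp : ∀ x, x ∉ ball (0 : ℂ) 1 → F x = 0) (hε : 0 < ε) :
    |2 * (∫ x, ∫ y, F x * F y * cutoffKernel ε x y) - (∫ x in ball (0 : ℂ) ε, F x) ^ 2|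
      ≤ 6 * (∫ x, F x) * ∫ x in ball (0 : ℂ) ε, F x * (‖x‖ / ε) := by
  have hi := integrable_mul_cutoffKernel hF hF0 hΛ hsupp hε
  have hs : Integrable (fun p : ℂ × ℂ => F p.1 * F p.2 * cutoffKernel ε p.2 p.1)
      (volume.prod volume) := by
    refine hi.swap.congr (Eventually.of_forall fun p => ?_)
    simp only [Function.comp, Prod.fst_swap, Prod.snd_swap]
    ring
  have hsw : ∫ p : ℂ × ℂ, F p.1 * F p.2 * cutoffKernel ε p.2 p.1 ∂(volume.prod volume)
      = ∫ p : ℂ × ℂ, F p.1 * F p.2 * cutoffKernel ε p.1 p.2 ∂(volume.prod volume) := by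
    rw [← integral_prod_swap]
    refine integral_congr_ae (Eventually.of_forall fun p => ?_)
    simp only [Prod.fst_swap, Prod.snd_swap]
    ring
  set G := (ball (0 : ℂ) ε).indicator F with hG
  set H := (ball (0 : ℂ) ε).indicator (fun x => F x * (‖x‖ / ε)) with hH
  have hGi : Integrable G := hF.indicator measurableSet_ball
  have hHi : Integrable H := by
    refine hF.mono ((hF.1.mul (by fun_prop : Continuous fun x : ℂ => ‖x‖ / ε).aestronglyMeasurable).indicator
      measurableSet_ball) (Eventually.of_forall fun x => ?_)
    by_cases hx : x ∈ ball (0 : ℂ) ε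
    · have hx' : ‖x‖ < ε := by simpa using hx
      simp only [hH, indicator_of_mem hx, norm_mul]
      rw [Real.norm_of_nonneg (by positivity : 0 ≤ ‖x‖ / ε)]
      exact mul_le_of_le_one_right (norm_nonneg _) ((div_le_one hε).2 hx'.le)
    · simp only [hH, indicator_of_notMem hx, norm_zero]; positivity
  have hGG : (∫ x in ball (0 : ℂ) ε, F x) ^ 2
      = ∫ p : ℂ × ℂ, G p.1 * G p.2 ∂(volume.prod volume) := by
    rw [integral_prod_mul, hG, integral_indicator measurableSet_ball, sq]
  have hA : ∫ x in ball (0 : ℂ) ε, F x * (‖x‖ / ε) = ∫ x, H x :=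
    (integral_indicator measurableSet_ball).symm
  have hGGi : Integrable (fun p : ℂ × ℂ => G p.1 * G p.2) (volume.prod volume) := hGi.mul_prod hGi
  have hFHi : Integrable (fun p : ℂ × ℂ => F p.1 * H p.2) (volume.prod volume) := hF.mul_prod hHi
  have hHFi : Integrable (fun p : ℂ × ℂ => H p.1 * F p.2) (volume.prod volume) := hHi.mul_prod hF
  have hb : 6 * (∫ x, F x) * ∫ x in ball (0 : ℂ) ε, F x * (‖x‖ / ε)
      = ∫ p : ℂ × ℂ, 3 * (H p.1 * F p.2 + F p.1 * H p.2) ∂(volume.prod volume) := by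
    rw [integral_const_mul, integral_add hHFi hFHi, integral_prod_mul, integral_prod_mul, hA]
    ring
  have hJ : ∫ x, ∫ y, F x * F y * cutoffKernel ε x y
      = ∫ p : ℂ × ℂ, F p.1 * F p.2 * cutoffKernel ε p.1 p.2 ∂(volume.prod volume) :=
    (integral_prod _ hi).symm
  have hL : 2 * (∫ x, ∫ y, F x * F y * cutoffKernel ε x y) - (∫ x in ball (0 : ℂ) ε, F x) ^ 2
      = ∫ p : ℂ × ℂ, (F p.1 * F p.2 * cutoffKernel ε p.1 p.2
        + F p.1 * F p.2 * cutoffKernel ε p.2 p.1) - G p.1 * G p.2 ∂(volume.prod volume) := by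
    rw [integral_sub ?_ hGGi, integral_add hi hs, hsw, hJ, hGG]
    swap
    · exact hi.add hs
    ring
  have hdiag : ∀ᵐ p : ℂ × ℂ ∂(volume.prod volume), p.1 ≠ p.2 := by
    have hm : MeasurableSet {p : ℂ × ℂ | p.1 = p.2} :=
      measurableSet_eq_fun measurable_fst measurable_snd
    rw [ae_iff]
    simp only [ne_eq, not_not]
    rw [Measure.measure_prod_null hm]
    refine Eventually.of_forall fun x => ?_
    have : Prod.mk x ⁻¹' {p : ℂ × ℂ | p.1 = p.2} = {x} := by
      ext y; simp [eq_comm]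
    simp [this]
  rw [hL, hb, ← Real.norm_eq_abs]
  refine norm_integral_le_of_norm_le ((hHFi.add hFHi).const_mul 3) ?_
  filter_upwards [hdiag] with p hp
  have h := cutoffKernel_add_swap hε hp
  have hFF : 0 ≤ F p.1 * F p.2 := mul_nonneg (hF0 _) (hF0 _)
  have hGe : ∀ x, G x = F x * (ball (0 : ℂ) ε).indicator 1 x := fun x => by
    by_cases hx : x ∈ ball (0 : ℂ) ε <;> simp [hG, hx]
  have hHe : ∀ x, H x = F x * (ball (0 : ℂ) ε).indicator (fun x => ‖x‖ / ε) x := fun x => by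
    by_cases hx : x ∈ ball (0 : ℂ) ε <;> simp [hH, hx]
  rw [hGe, hGe, hHe, hHe, Real.norm_eq_abs]
  calc _ = |F p.1 * F p.2 * (cutoffKernel ε p.1 p.2 + cutoffKernel ε p.2 p.1
      - (ball (0 : ℂ) ε).indicator 1 p.1 * (ball (0 : ℂ) ε).indicator 1 p.2)| := by
        congr 1; ring
    _ ≤ F p.1 * F p.2 * (3 * ((ball (0 : ℂ) ε).indicator (fun x => ‖x‖ / ε) p.1
      + (ball (0 : ℂ) ε).indicator (fun x => ‖x‖ / ε) p.2)) := by
        rw [abs_mul, abs_of_nonneg hFF]; gcongr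
    _ = _ := by ring

end

section

variable {V v : ℂ → ℝ} {a b K C₀ lam : ℝ}

namespace IsSol

lemma abs_fderiv_self_add_le (hW : IsWeight V a b K) (hS : IsSol V C₀ lam v) {C x}
    (hx : ‖x‖ ≤ 1 / 4) (hC : ∀ x : ℂ, 1 / 4 ≤ ‖x‖ → ‖x‖ ≤ 1 → v x ≤ C) :
    |2 * Real.pi * fderiv ℝ v x x
      + ∫ y, massDensity V lam v y * (inner ℝ x (x - y) / ‖x - y‖ ^ 2)|
    ≤ ‖x‖ * (8 * Real.pi * C + 2 * (b * C₀)) := by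
  set F := massDensity V lam v with hF
  have hF0 : ∀ y, 0 ≤ F y := massDensity_nonneg hW hS
  have hFi : Integrable F := integrable_massDensity hW hS
  have hpi : -Real.pi ≤ Real.pi := by linarith [Real.pi_pos]
  have hsub := closedBall_half_subset hx
  have hcircle : |∫ θ in (-Real.pi)..Real.pi, v (x + (1 / 2 : ℝ) • cis θ) * inner ℝ x (cis θ)|
      ≤ C * ‖x‖ * (2 * Real.pi) := by
    have h := intervalIntegral.norm_integral_le_of_norm_le_const (a := -Real.pi) (b := Real.pi)
      (f := fun θ => v (x + (1 / 2 : ℝ) • cis θ) * inner ℝ x (cis θ)) (C := C * ‖x‖)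
      fun θ _ => by
        have hb := circle_half_bounds hW hS hx hC θ
        rw [norm_mul, Real.norm_of_nonneg hb.1]
        have h2 := norm_inner_le_norm (𝕜 := ℝ) x (cis θ)
        rw [norm_cis, mul_one] at h2
        exact mul_le_mul hb.2 h2 (norm_nonneg _) (hb.1.trans hb.2)
    rw [sub_neg_eq_add, ← two_mul, abs_of_pos Real.two_pi_pos] at h
    exact h
  have hk := grad_kernel_mul (x := x) (R := 1 / 2) (by norm_num)
    ((continuousOn_massDensity hW hS).mono hsub) x
  set k : ℂ → ℝ := fun y => inner ℝ x (y - x) * ((‖y - x‖ ^ 2)⁻¹ - ((1 / 2 : ℝ) ^ 2)⁻¹) * F y with hkdef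
  have hki : Integrable ((ball x (1 / 2)).indicator k) :=
    (integrable_indicator_iff measurableSet_ball).2 hk.1
  set D : ℂ → ℝ := fun y => F y * (inner ℝ x (x - y) / ‖x - y‖ ^ 2)
    + (ball x (1 / 2)).indicator k y with hD
  have hDle : ∀ y, ‖D y‖ ≤ 2 * ‖x‖ * F y := by
    intro y
    by_cases hy : y ∈ ball x (1 / 2)
    · have hy' : ‖y - x‖ < 1 / 2 := by simpa [dist_eq_norm] using hy
      have e : D y = F y * (4 * inner ℝ x (x - y)) := by
        simp only [hD, hkdef, indicator_of_mem hy]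
        rw [← neg_sub y x, norm_neg, inner_neg_right]
        ring
      rw [e, norm_mul, norm_mul, Real.norm_of_nonneg (hF0 y)]
      have h2 := norm_inner_le_norm (𝕜 := ℝ) x (x - y)
      rw [norm_sub_rev x y] at h2
      have h3 : ‖x‖ * ‖y - x‖ ≤ ‖x‖ * (1 / 2) := by gcongr
      rw [Real.norm_of_nonneg (by norm_num : (0 : ℝ) ≤ 4)]
      nlinarith [hF0 y]
    · have hy' : 1 / 2 ≤ ‖x - y‖ := by
        simpa [dist_eq_norm, norm_sub_rev] using hy
      simp only [hD, indicator_of_notMem hy, add_zero]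
      rw [norm_mul, Real.norm_of_nonneg (hF0 y), mul_comm]
      gcongr
      · exact hF0 y
      · refine (abs_inner_div_le _ _).trans ?_
        rw [mul_comm]
        gcongr
        rw [inv_le_comm₀ (by linarith) (by norm_num)]
        linarith
  have hDi : Integrable D := by
    refine (hFi.const_mul (2 * ‖x‖)).mono' ?_ (Eventually.of_forall hDle)
    refine (hFi.1.mul ?_).add hki.1
    exact (Measurable.div (by fun_prop : Continuous fun y : ℂ => (inner ℝ x (x - y) : ℝ)).measurable
      (by fun_prop)).aestronglyMeasurable
  have hsplit : ∫ y, F y * (inner ℝ x (x - y) / ‖x - y‖ ^ 2)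
      = (∫ y, D y) - ∫ y in ball x (1 / 2), k y := by
    rw [← integral_indicator measurableSet_ball, ← integral_sub hDi hki]
    simp [hD]
  have hDint : |∫ y, D y| ≤ 2 * ‖x‖ * (b * C₀) := by
    refine (norm_integral_le_of_norm_le (hFi.const_mul (2 * ‖x‖)) (Eventually.of_forall hDle)).trans ?_
    rw [integral_const_mul]
    gcongr
    exact integral_massDensity_le hW hS
  have hrep : 2 * Real.pi * fderiv ℝ v x x = 2 / (1 / 2) * (∫ θ in (-Real.pi)..Real.pi,
      v (x + (1 / 2 : ℝ) • cis θ) * inner ℝ x (cis θ)) + ∫ y in ball x (1 / 2), k y :=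
    hS.fderiv_rep (by norm_num : (0 : ℝ) < 1 / 2) hsub x
  rw [hrep, hsplit]
  rw [abs_le] at hcircle hDint ⊢
  constructor <;> linarith

/-- Local quantization of the mass, up to the first moment of the density. -/
lemma abs_mass_mul_le (hW : IsWeight V a b K) (hS : IsSol V C₀ lam v) {C ε : ℝ} (hε : 0 < ε)
    (hε4 : ε ≤ 1 / 4) (hC : ∀ x : ℂ, 1 / 4 ≤ ‖x‖ → ‖x‖ ≤ 1 → v x ≤ C) :
    |(∫ x in ball (0 : ℂ) ε, massDensity V lam v x)
      * (16 * Real.pi - ∫ x in ball (0 : ℂ) ε, massDensity V lam v x)|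
    ≤ 2 * (2 * Real.pi * (6 + K / a) + 8 * Real.pi * C + 5 * (b * C₀))
      * ∫ x in ball (0 : ℂ) ε, massDensity V lam v x * (‖x‖ / ε) := by
  have hpoh := hS.pohozaev hW hε (by linarith)
  have hfd := fun x hx => abs_fderiv_self_add_le (x := x) hW hS hx hC
  set F := massDensity V lam v with hF
  have hF0 : ∀ y, 0 ≤ F y := massDensity_nonneg hW hS
  have hFi : Integrable F := integrable_massDensity hW hS
  have hlam := hS.lam_pos
  have ha := hW.pos
  have hm := integral_massDensity_le hW hS
  obtain ⟨Mv, hMv⟩ := (isCompact_closedBall (0 : ℂ) 1).bddAbove_image hS.cont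
  have hΛ : ∀ y, F y ≤ lam * b * Real.exp Mv := fun y => massDensity_le hW hS fun hy =>
    hMv (mem_image_of_mem _ (ball_subset_closedBall hy))
  have hsupp : ∀ x, x ∉ ball (0 : ℂ) 1 → F x = 0 := fun x hx => indicator_of_notMem hx _
  have hJi := (integrable_mul_cutoffKernel hFi hF0 hΛ hsupp hε).integral_prod_left
  have hsym := abs_integral_cutoffKernel_sub_le hFi hF0 hΛ hsupp hε
  set σ := ∫ x in ball (0 : ℂ) ε, F x
  set A := ∫ x in ball (0 : ℂ) ε, F x * (‖x‖ / ε) with hAdef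
  set J := ∫ x, ∫ y, F x * F y * cutoffKernel ε x y with hJdef
  have hC0 : 0 ≤ C := (hS.nonneg hW 1 (by simp)).trans (hC 1 (by norm_num) (by simp))
  have hm0 : 0 ≤ ∫ x, F x := integral_nonneg hF0
  have hsub : closedBall (0 : ℂ) ε ⊆ ball 0 1 := closedBall_subset_ball (by linarith)
  have hFc := (continuousOn_massDensity hW hS).mono hsub
  have hdV : ContinuousOn (fun x => fderiv ℝ V x x) (closedBall (0 : ℂ) ε) :=
    ((hW.c1.continuousOn_fderiv_of_isOpen isOpen_ball le_rfl).mono hsub).clm_apply continuousOn_id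
  have hdv : ContinuousOn (fun x => fderiv ℝ v x x) (closedBall (0 : ℂ) ε) :=
    ((hS.c2.continuousOn_fderiv_of_isOpen isOpen_ball (by norm_num)).mono hsub).clm_apply
      continuousOn_id
  have hvc := (hS.cont.mono (hsub.trans ball_subset_closedBall)).rexp
  have hint : ∀ {g : ℂ → ℝ}, ContinuousOn g (closedBall (0 : ℂ) ε) → IntegrableOn g (ball 0 ε) :=
    fun hg => (hg.integrableOn_compact (isCompact_closedBall _ _)).mono_set ball_subset_closedBall
  have hAi : IntegrableOn (fun x => F x * (‖x‖ / ε)) (ball 0 ε) := hint (by fun_prop)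
  have hA0 : 0 ≤ A := setIntegral_nonneg measurableSet_ball fun x _ =>
    mul_nonneg (hF0 x) (by positivity)
  set T : ℝ := ∫ x in ball (0 : ℂ) ε, (1 - ‖x‖ ^ 2 / ε ^ 2) * F x * fderiv ℝ v x x with hT
  have hTi : IntegrableOn (fun x => (1 - ‖x‖ ^ 2 / ε ^ 2) * F x * fderiv ℝ v x x) (ball 0 ε) :=
    hint (by fun_prop)
  have hs : ∀ x ∈ ball (0 : ℂ) ε, 0 ≤ ‖x‖ ^ 2 / ε ^ 2 ∧ ‖x‖ ^ 2 / ε ^ 2 ≤ ‖x‖ / ε ∧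
      ‖x‖ ^ 2 / ε ^ 2 ≤ 1 := by
    intro x hx
    have hx' : ‖x‖ < ε := by simpa using hx
    have h1 : ‖x‖ / ε ≤ 1 := by rw [div_le_one hε]; exact hx'.le
    have h0 : 0 ≤ ‖x‖ / ε := by positivity
    rw [← div_pow]
    refine ⟨by positivity, by nlinarith, by nlinarith⟩
  have h1 : |T + 4 * σ| ≤ (6 + K / a) * A := by
    have e : T + 4 * σ = ∫ x in ball (0 : ℂ) ε, (((1 - ‖x‖ ^ 2 / ε ^ 2) * F x * fderiv ℝ v x x
        + 4 * F x) - lam * ‖x‖ ^ 2 * Real.exp (v x) * (V x * (-2 * ‖x‖ ^ 2 / ε ^ 2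
      + (1 - ‖x‖ ^ 2 / ε ^ 2) * (4 + fderiv ℝ v x x)) + (1 - ‖x‖ ^ 2 / ε ^ 2) * fderiv ℝ V x x)) := by
      have hVc := hW.cont.mono (hsub.trans ball_subset_closedBall)
      rw [integral_sub, integral_add hTi (hFi.integrableOn.const_mul 4), hpoh, integral_const_mul,
        sub_zero]
      · exact hTi.add (hFi.integrableOn.const_mul 4)
      · exact hint (by fun_prop)
    rw [e, ← Real.norm_eq_abs, hAdef, ← integral_const_mul]
    refine norm_integral_le_of_norm_le (hAi.const_mul _)
      ((ae_restrict_iff' measurableSet_ball).2 (Eventually.of_forall fun x hx => ?_))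
    have hx1 := hsub (ball_subset_closedBall hx)
    have hx' : ‖x‖ < ε := by simpa using hx
    obtain ⟨h0, h1, h2⟩ := hs x hx
    have hFe : F x = lam * ‖x‖ ^ 2 * V x * Real.exp (v x) := massDensity_eq hx1
    have e2 : ((1 - ‖x‖ ^ 2 / ε ^ 2) * F x * fderiv ℝ v x x
        + 4 * F x) - lam * ‖x‖ ^ 2 * Real.exp (v x) * (V x * (-2 * ‖x‖ ^ 2 / ε ^ 2
      + (1 - ‖x‖ ^ 2 / ε ^ 2) * (4 + fderiv ℝ v x x)) + (1 - ‖x‖ ^ 2 / ε ^ 2) * fderiv ℝ V x x)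
      = F x * (6 * (‖x‖ ^ 2 / ε ^ 2))
        - (1 - ‖x‖ ^ 2 / ε ^ 2) * (lam * ‖x‖ ^ 2 * Real.exp (v x) * fderiv ℝ V x x) := by
      rw [hFe]; ring
    have hVx := hW.lower x (ball_subset_closedBall hx1)
    have hd : ‖fderiv ℝ V x‖ ≤ K := hW.deriv x (by
      rw [mem_closedBall_zero_iff]; linarith)
    have hdx : |fderiv ℝ V x x| ≤ K * (‖x‖ / ε) := by
      refine ((fderiv ℝ V x).le_opNorm x).trans ?_
      gcongr
      · exact (norm_nonneg _).trans hd
      rw [le_div_iff₀ hε]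
      exact mul_le_of_le_one_right (norm_nonneg _) (by linarith)
    have hle : lam * ‖x‖ ^ 2 * Real.exp (v x) ≤ F x / a := by
      rw [le_div_iff₀ ha, hFe]
      calc lam * ‖x‖ ^ 2 * Real.exp (v x) * a = lam * ‖x‖ ^ 2 * a * Real.exp (v x) := by ring
        _ ≤ _ := by gcongr
    have h3 : |lam * ‖x‖ ^ 2 * Real.exp (v x) * fderiv ℝ V x x| ≤ F x / a * (K * (‖x‖ / ε)) := by
      rw [abs_mul, abs_of_nonneg (by positivity : 0 ≤ lam * ‖x‖ ^ 2 * Real.exp (v x))]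
      exact mul_le_mul hle hdx (abs_nonneg _) (div_nonneg (hF0 x) ha.le)
    rw [e2]
    calc _ ≤ |F x * (6 * (‖x‖ ^ 2 / ε ^ 2))| + |(1 - ‖x‖ ^ 2 / ε ^ 2)
          * (lam * ‖x‖ ^ 2 * Real.exp (v x) * fderiv ℝ V x x)| := abs_sub _ _
      _ ≤ F x * (6 * (‖x‖ / ε)) + 1 * (F x / a * (K * (‖x‖ / ε))) := by
          have := hF0 x
          rw [abs_of_nonneg (by positivity), abs_mul (1 - ‖x‖ ^ 2 / ε ^ 2)]
          gcongr
          rw [abs_le]; constructor <;> linarith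
      _ = _ := by field_simp
  have h2 : |2 * Real.pi * T + J| ≤ (8 * Real.pi * C + 2 * (b * C₀)) * A := by
    have e : 2 * Real.pi * T + J = ∫ x, ((ball (0 : ℂ) ε).indicator (fun x => 2 * Real.pi *
        ((1 - ‖x‖ ^ 2 / ε ^ 2) * F x * fderiv ℝ v x x)) x + ∫ y, F x * F y * cutoffKernel ε x y) := by
      rw [integral_add ((integrable_indicator_iff measurableSet_ball).2 (hTi.const_mul _)) hJi,
        integral_indicator measurableSet_ball, integral_const_mul]
    have hA' : (8 * Real.pi * C + 2 * (b * C₀)) * A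
        = ∫ x, (ball (0 : ℂ) ε).indicator (fun x => (8 * Real.pi * C + 2 * (b * C₀)) *
          (F x * (‖x‖ / ε))) x := by
      rw [integral_indicator measurableSet_ball, integral_const_mul]
    rw [e, hA', ← Real.norm_eq_abs]
    refine norm_integral_le_of_norm_le
      ((integrable_indicator_iff measurableSet_ball).2 (hAi.const_mul _))
      (Eventually.of_forall fun x => ?_)
    by_cases hx : x ∈ ball (0 : ℂ) ε
    · have hx' : ‖x‖ < ε := by simpa using hx
      obtain ⟨h0, h1, h2⟩ := hs x hx
      rw [indicator_of_mem hx, indicator_of_mem hx]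
      have e3 : ∫ y, F x * F y * cutoffKernel ε x y = (1 - ‖x‖ ^ 2 / ε ^ 2) * F x *
          ∫ y, F y * (inner ℝ x (x - y) / ‖x - y‖ ^ 2) := by
        rw [← integral_const_mul]
        refine integral_congr_ae (Eventually.of_forall fun y => ?_)
        simp only [cutoffKernel, indicator_of_mem hx]
        ring
      rw [e3]
      have e4 : ∀ d I : ℝ, 2 * Real.pi * ((1 - ‖x‖ ^ 2 / ε ^ 2) * F x * d)
          + (1 - ‖x‖ ^ 2 / ε ^ 2) * F x * I
          = (1 - ‖x‖ ^ 2 / ε ^ 2) * F x * (2 * Real.pi * d + I) := fun d I => by ring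
      rw [e4, norm_mul, norm_mul, Real.norm_of_nonneg (hF0 x), Real.norm_of_nonneg (by linarith)]
      have hb0 : 0 ≤ 8 * Real.pi * C + 2 * (b * C₀) := by
        have := Real.pi_pos
        have : 0 ≤ b * C₀ := hm0.trans hm
        positivity
      calc _ ≤ 1 * F x * (‖x‖ * (8 * Real.pi * C + 2 * (b * C₀))) := by
            have := hF0 x
            gcongr
            · linarith
            · exact hfd x (by linarith)
        _ = F x * (8 * Real.pi * C + 2 * (b * C₀)) * ‖x‖ := by ring
        _ ≤ F x * (8 * Real.pi * C + 2 * (b * C₀)) * (‖x‖ / ε) := by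
            have := hF0 x
            gcongr
            rw [le_div_iff₀ hε]
            exact mul_le_of_le_one_right (norm_nonneg _) (by linarith)
        _ = _ := by ring
    · rw [indicator_of_notMem hx, indicator_of_notMem hx]
      simp [cutoffKernel_of_notMem hx]
  have h3 : |2 * J - σ ^ 2| ≤ 6 * (b * C₀) * A := hsym.trans (by gcongr)
  have e : σ * (16 * Real.pi - σ)
      = 4 * Real.pi * (T + 4 * σ) - 2 * (2 * Real.pi * T + J) + (2 * J - σ ^ 2) := by ring
  rw [e]
  calc _ ≤ |4 * Real.pi * (T + 4 * σ)| + |2 * (2 * Real.pi * T + J)| + |2 * J - σ ^ 2| :=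
        (abs_add_le _ _).trans (by gcongr; exact abs_sub _ _)
    _ = 4 * Real.pi * |T + 4 * σ| + 2 * |2 * Real.pi * T + J| + |2 * J - σ ^ 2| := by
        rw [abs_mul, abs_mul 2, abs_of_pos (by positivity : 0 < 4 * Real.pi), abs_two]
    _ ≤ 4 * Real.pi * ((6 + K / a) * A) + 2 * ((8 * Real.pi * C + 2 * (b * C₀)) * A)
        + 6 * (b * C₀) * A := by gcongr
    _ = _ := by ring

end IsSol

end

section

variable {V v : ℂ → ℝ} {a b K C₀ lam : ℝ}

lemma sum_dyadic_le {t : ℝ} (ht : 0 ≤ t) (N : ℕ) :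
    ∑ j ∈ Finset.range N, (if t * 2 ^ j < 1 then t * 2 ^ j else 0) ≤ t * 2 ^ N ∧
    ∑ j ∈ Finset.range N, (if t * 2 ^ j < 1 then t * 2 ^ j else 0) ≤ 2 := by
  induction N with
  | zero => simp [ht]
  | succ N ih =>
    have h0 : 0 ≤ t * 2 ^ N := by positivity
    rw [Finset.sum_range_succ, pow_succ]
    split_ifs with h
    · constructor <;> linarith
    · constructor <;> linarith

namespace IsSol

lemma exists_dyadic_moment_le (hW : IsWeight V a b K) (hS : IsSol V C₀ lam v) {ε : ℝ} (hε : 0 < ε)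
    {N : ℕ} (hN : 0 < N) : ∃ j < N, ∫ x in ball (0 : ℂ) (ε / 2 ^ j),
      massDensity V lam v x * (‖x‖ / (ε / 2 ^ j)) ≤ 2 * (b * C₀) / N := by
  set F := massDensity V lam v with hF
  have hF0 : ∀ y, 0 ≤ F y := massDensity_nonneg hW hS
  have hFi : Integrable F := integrable_massDensity hW hS
  set g : ℕ → ℂ → ℝ := fun j x => F x * (if ‖x‖ / ε * 2 ^ j < 1 then ‖x‖ / ε * 2 ^ j else 0) with hg
  have hmeas : ∀ j : ℕ, Measurable fun x : ℂ =>
      if ‖x‖ / ε * 2 ^ j < 1 then ‖x‖ / ε * 2 ^ j else 0 := fun j =>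
    Measurable.ite (measurableSet_lt (by fun_prop) measurable_const) (by fun_prop) measurable_const
  have hgi : ∀ j, Integrable (g j) := fun j => by
    refine hFi.mono (hFi.1.mul (hmeas j).aestronglyMeasurable) (Eventually.of_forall fun x => ?_)
    rw [norm_mul]
    refine mul_le_of_le_one_right (norm_nonneg _) ?_
    split_ifs with h
    · rw [Real.norm_of_nonneg (by positivity)]; exact h.le
    · simp
  have hA : ∀ j, ∫ x in ball (0 : ℂ) (ε / 2 ^ j), F x * (‖x‖ / (ε / 2 ^ j)) = ∫ x, g j x := fun j => by
    rw [← integral_indicator measurableSet_ball]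
    refine integral_congr_ae (Eventually.of_forall fun x => ?_)
    have hiff : x ∈ ball (0 : ℂ) (ε / 2 ^ j) ↔ ‖x‖ / ε * 2 ^ j < 1 := by
      rw [mem_ball_zero_iff, lt_div_iff₀ (by positivity), div_mul_eq_mul_div, div_lt_one hε]
    by_cases h : x ∈ ball (0 : ℂ) (ε / 2 ^ j)
    · simp only [hg, indicator_of_mem h, if_pos (hiff.1 h)]
      field_simp
    · simp only [hg, indicator_of_notMem h, if_neg (fun h' => h (hiff.2 h')), mul_zero]
  have hsum : ∑ j ∈ Finset.range N, ∫ x, g j x ≤ ∑ j ∈ Finset.range N, 2 * (b * C₀) / N := by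
    rw [← integral_finsetSum _ fun j _ => hgi j, Finset.sum_const, Finset.card_range, nsmul_eq_mul,
      mul_div_cancel₀ _ (by positivity : (N : ℝ) ≠ 0)]
    calc _ ≤ ∫ x, 2 * F x := by
          refine integral_mono (integrable_finsetSum _ fun j _ => hgi j) (hFi.const_mul 2) fun x => ?_
          simp only [hg, ← Finset.mul_sum]
          rw [mul_comm 2]
          exact mul_le_mul_of_nonneg_left (sum_dyadic_le (by positivity) N).2 (hF0 x)
      _ ≤ _ := by
          rw [integral_const_mul]
          gcongr
          exact integral_massDensity_le hW hS
  obtain ⟨j, hj, hle⟩ := Finset.exists_le_of_sum_le (Finset.nonempty_range_iff.2 hN.ne') hsum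
  exact ⟨j, Finset.mem_range.1 hj, (hA j).trans_le hle⟩

lemma mass_mono (hW : IsWeight V a b K) (hS : IsSol V C₀ lam v) {s t : Set ℂ} (hst : s ⊆ t) :
    ∫ x in s, massDensity V lam v x ≤ ∫ x in t, massDensity V lam v x :=
  setIntegral_mono_set (integrable_massDensity hW hS).integrableOn
    (Eventually.of_forall (massDensity_nonneg hW hS)) (Eventually.of_forall hst)

/-- Large values of the solution force a definite amount of mass near the origin. -/
lemma two_pi_le_mass (hW : IsWeight V a b K) (hS : IsSol V C₀ lam v) {ρ C C' : ℝ} (hρ0 : 0 < ρ)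
    (hρ : ρ ≤ 1 / 4) (hC : ∀ x : ℂ, 1 / 4 ≤ ‖x‖ → ‖x‖ ≤ 1 → v x ≤ C)
    (hC' : ∀ x : ℂ, ρ / 2 ≤ ‖x‖ → ‖x‖ ≤ 1 → v x ≤ C')
    (hM : ∃ x ∈ ball (0 : ℂ) 1, max C' ((2 * Real.pi * C + Real.log (1 / ρ) * (b * C₀)
      + 4 * Real.pi * (b * C₀)) / Real.pi) < v x) :
    2 * Real.pi ≤ ∫ x in ball (0 : ℂ) ρ, massDensity V lam v x := by
  obtain ⟨x0, hx0, hmax⟩ := (isCompact_closedBall (0 : ℂ) 1).exists_isMaxOn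
    (nonempty_closedBall.2 zero_le_one) hS.cont
  obtain ⟨x, hx, hlt⟩ := hM
  have hlt0 := hlt.trans_le (hmax (ball_subset_closedBall hx))
  obtain ⟨h1, h2⟩ := max_lt_iff.1 hlt0
  have hx0' : ‖x0‖ ≤ 1 := by simpa using hx0
  have hn : ‖x0‖ < ρ / 2 := by
    by_contra! h
    exact absurd (hC' x0 h hx0') (not_le.2 h1)
  have h := hS.max_le hW hρ0 hρ hC (fun y hy => hmax hy) hn rfl
  rw [div_lt_iff₀ Real.pi_pos] at h2
  have hC0 : 0 ≤ C := (hS.nonneg hW 1 (by simp)).trans (hC 1 (by norm_num) (by simp))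
  have hL : 0 ≤ Real.log (1 / ρ) := Real.log_nonneg (by rw [one_le_div hρ0]; linarith)
  have hm : 0 ≤ b * C₀ := (integral_nonneg (massDensity_nonneg hW hS)).trans
    (integral_massDensity_le hW hS)
  have hpos : 0 < v x0 := by
    have h3 : 0 ≤ 2 * Real.pi * C + Real.log (1 / ρ) * (b * C₀) + 4 * Real.pi * (b * C₀) := by
      have := Real.pi_pos; positivity
    exact pos_of_mul_pos_left (h3.trans_lt h2) Real.pi_pos.le
  by_contra! hlt2
  nlinarith

/-- On one of the dyadic scales the mass is close to its quantized value. -/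
lemma exists_mass_near (hW : IsWeight V a b K) (hS : IsSol V C₀ lam v) {ε C : ℝ} (hε : 0 < ε)
    (hε4 : ε ≤ 1 / 4) (hC : ∀ x : ℂ, 1 / 4 ≤ ‖x‖ → ‖x‖ ≤ 1 → v x ≤ C) {N : ℕ} (hN : 0 < N)
    (hσ : 2 * Real.pi ≤ ∫ x in ball (0 : ℂ) (ε / 2 ^ N), massDensity V lam v x) :
    ∃ ε' : ℝ, ε / 2 ^ N ≤ ε' ∧ ε' ≤ ε ∧
      |(∫ x in ball (0 : ℂ) ε', massDensity V lam v x) - 16 * Real.pi|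
        ≤ (2 * (2 * Real.pi * (6 + K / a) + 8 * Real.pi * C + 5 * (b * C₀)) * (2 * (b * C₀))) / N := by
  obtain ⟨j, hj, hA⟩ := exists_dyadic_moment_le hW hS hε hN
  have h1 : ε / 2 ^ N ≤ ε / 2 ^ j := by gcongr; norm_num
  have h2 : ε / 2 ^ j ≤ ε := div_le_self hε.le (one_le_pow₀ (by norm_num))
  have h3 := hS.abs_mass_mul_le hW (by positivity : 0 < ε / 2 ^ j) (h2.trans hε4) hC
  have h4 := hσ.trans (mass_mono hW hS (ball_subset_ball h1))
  refine ⟨ε / 2 ^ j, h1, h2, ?_⟩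
  have hC0 : 0 ≤ C := (hS.nonneg hW 1 (by simp)).trans (hC 1 (by norm_num) (by simp))
  have hm : 0 ≤ b * C₀ := (integral_nonneg (massDensity_nonneg hW hS)).trans
    (integral_massDensity_le hW hS)
  have hK : 0 ≤ K := (norm_nonneg _).trans (hW.deriv 0 (by simp))
  have ha := hW.pos
  set D := 2 * (2 * Real.pi * (6 + K / a) + 8 * Real.pi * C + 5 * (b * C₀)) with hD
  have hD0 : 0 ≤ D := by have := Real.pi_pos; positivity
  rw [abs_mul, abs_of_nonneg (by linarith [Real.pi_pos]), abs_sub_comm] at h3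
  calc _ ≤ 1 * |(∫ x in ball (0 : ℂ) (ε / 2 ^ j), massDensity V lam v x) - 16 * Real.pi| := by simp
    _ ≤ (∫ x in ball (0 : ℂ) (ε / 2 ^ j), massDensity V lam v x)
        * |(∫ x in ball (0 : ℂ) (ε / 2 ^ j), massDensity V lam v x) - 16 * Real.pi| := by
        gcongr; linarith [Real.pi_gt_three]
    _ ≤ D * (2 * (b * C₀) / N) := h3.trans (by gcongr)
    _ = _ := by ring

lemma log_mul_mass_le (hW : IsWeight V a b K) (hS : IsSol V C₀ lam v) {C ε : ℝ} {x : ℂ}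
    (hx0 : x ≠ 0) (hx : ‖x‖ ≤ 1 / 8) (hε : ε ≤ ‖x‖)
    (hC : ∀ x : ℂ, 1 / 4 ≤ ‖x‖ → ‖x‖ ≤ 1 → v x ≤ C) :
    Real.log (1 / (4 * ‖x‖)) * (∫ y in ball (0 : ℂ) ε, massDensity V lam v y)
      ≤ 2 * Real.pi * v x := by
  refine le_trans ?_ (hS.rep_bounds hW (by linarith) hC).1
  have hF0 := massDensity_nonneg hW hS
  have hFi := integrable_massDensity hW hS
  have hxp : 0 < ‖x‖ := norm_pos_iff.2 hx0
  have hd : ∀ y ∈ ball (0 : ℂ) ε, ‖y - x‖ ≤ 2 * ‖x‖ := fun y hy => by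
    have hy' : ‖y‖ < ε := by simpa using hy
    linarith [norm_sub_le y x]
  have hi := integrableOn_rep hW hS (by norm_num : (0 : ℝ) < 1 / 2)
    (closedBall_half_subset (x := x) (by linarith))
  have hsub : ball (0 : ℂ) ε ⊆ ball x (1 / 2) := fun y hy => by
    rw [mem_ball, dist_eq_norm]; linarith [hd y hy]
  rw [← integral_const_mul]
  calc _ ≤ ∫ y in ball (0 : ℂ) ε, Real.log (1 / 2 / ‖y - x‖) * massDensity V lam v y := by
        refine setIntegral_mono_on_ae (hFi.integrableOn.const_mul _) (hi.mono_set hsub)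
          measurableSet_ball ?_
        have : ∀ᵐ y : ℂ, y ≠ x := by simp [ae_iff]
        filter_upwards [this] with y hyx hy
        have hp : 0 < ‖y - x‖ := norm_pos_iff.2 (sub_ne_zero.2 hyx)
        have := hF0 y
        gcongr Real.log ?_ * _
        rw [div_div, one_div_le_one_div (by positivity) (by positivity)]
        linarith [hd y hy]
    _ ≤ _ := by
        refine setIntegral_mono_set hi ((ae_restrict_iff' measurableSet_ball).2
          (Eventually.of_forall fun y hy => mul_nonneg ?_ (hF0 y))) (Eventually.of_forall hsub)
        rcases eq_or_ne y x with rfl | hyx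
        · simp
        have hp : 0 < ‖y - x‖ := norm_pos_iff.2 (sub_ne_zero.2 hyx)
        have hy' : ‖y - x‖ < 1 / 2 := by simpa [dist_eq_norm] using hy
        exact Real.log_nonneg ((one_le_div hp).2 hy'.le)

lemma le_log_mul_mass (hW : IsWeight V a b K) (hS : IsSol V C₀ lam v) {C C' : ℝ} {x : ℂ}
    (hx0 : x ≠ 0) (hx : ‖x‖ ≤ 1 / 4) (hC : ∀ x : ℂ, 1 / 4 ≤ ‖x‖ → ‖x‖ ≤ 1 → v x ≤ C)
    (hC' : ∀ y : ℂ, ‖x‖ / 2 ≤ ‖y‖ → ‖y‖ ≤ 1 → v y ≤ C') :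
    2 * Real.pi * v x ≤ 2 * Real.pi * C
      + Real.log (1 / ‖x‖) * (∫ y in ball (0 : ℂ) ‖x‖, massDensity V lam v y)
      + lam * b * Real.exp C' * (Real.pi / 2) := by
  refine (hS.rep_bounds hW hx hC).2.trans ?_
  set F := massDensity V lam v with hF
  have hF0 : ∀ y, 0 ≤ F y := massDensity_nonneg hW hS
  have hFi : Integrable F := integrable_massDensity hW hS
  have hlam := hS.lam_pos
  have hb := hW.upper_pos
  have hxp : 0 < ‖x‖ := norm_pos_iff.2 hx0
  have hL : 0 ≤ Real.log (1 / ‖x‖) := Real.log_nonneg (by rw [one_le_div hxp]; linarith)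
  have hi := integrableOn_rep hW hS (by norm_num : (0 : ℝ) < 1 / 2)
    (closedBall_half_subset (x := x) (by linarith))
  have hiF : Integrable ((ball (0 : ℂ) ‖x‖).indicator F) := hFi.indicator measurableSet_ball
  have hinv := integrableOn_inv_dist x (1 / 2)
  set Λ := lam * b * Real.exp C' with hΛ
  have hpt : ∀ y ∈ ball x (1 / 2), Real.log (1 / 2 / ‖y - x‖) * F y
      ≤ Real.log (1 / ‖x‖) * (ball (0 : ℂ) ‖x‖).indicator F y + Λ / 2 * ‖y - x‖⁻¹ := by
    intro y _
    have hind : 0 ≤ (ball (0 : ℂ) ‖x‖).indicator F y := indicator_nonneg (fun y _ => hF0 y) y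
    by_cases hy : ‖y‖ < ‖x‖ / 2
    · have hyb : y ∈ ball (0 : ℂ) ‖x‖ := by rw [mem_ball_zero_iff]; linarith
      have hd : ‖x‖ / 2 ≤ ‖y - x‖ := by
        have := norm_sub_norm_le x y
        rw [norm_sub_rev] at this; linarith
      rw [indicator_of_mem hyb]
      refine le_add_of_le_of_nonneg ?_ (by positivity)
      have := hF0 y
      gcongr Real.log ?_ * _
      · have : 0 < ‖y - x‖ := by linarith
        positivity
      rw [div_div]
      exact one_div_le_one_div_of_le hxp (by linarith)
    · have hFy : F y ≤ Λ := massDensity_le hW hS fun hyb =>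
        hC' y (not_lt.1 hy) (mem_ball_zero_iff.1 hyb).le
      refine le_add_of_nonneg_of_le (by positivity) ?_
      calc _ ≤ 1 / 2 / ‖y - x‖ * F y := by
            have := hF0 y
            gcongr
            exact Real.log_le_self (by positivity)
        _ ≤ 1 / 2 / ‖y - x‖ * Λ := by gcongr
        _ = _ := by field_simp
  have h1 : ∫ y in ball x (1 / 2), (ball (0 : ℂ) ‖x‖).indicator F y ≤ ∫ y in ball (0 : ℂ) ‖x‖, F y := by
    rw [← integral_indicator measurableSet_ball (s := ball (0 : ℂ) ‖x‖)]
    exact setIntegral_le_integral hiF (Eventually.of_forall fun y => indicator_nonneg (fun y _ => hF0 y) y)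
  have hiadd : IntegrableOn (fun y => Real.log (1 / ‖x‖) * (ball (0 : ℂ) ‖x‖).indicator F y
      + Λ / 2 * ‖y - x‖⁻¹) (ball x (1 / 2)) :=
    (hiF.integrableOn.const_mul (Real.log (1 / ‖x‖))).add (hinv.const_mul (Λ / 2))
  have h2 := setIntegral_mono_on hi hiadd measurableSet_ball hpt
  rw [integral_add (hiF.integrableOn.const_mul (Real.log (1 / ‖x‖))) (hinv.const_mul (Λ / 2)),
    integral_const_mul, integral_const_mul, integral_inv_dist x (by norm_num)] at h2
  have h3 := mul_le_mul_of_nonneg_left h1 hL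
  linarith

/-- A large mass near the origin forces the parameter to be small. -/
lemma lam_le_sq (hW : IsWeight V a b K) (hS : IsSol V C₀ lam v) {C ε : ℝ} (hε : 0 < ε)
    (hε16 : ε ≤ 1 / 16) (hC : ∀ x : ℂ, 1 / 4 ≤ ‖x‖ → ‖x‖ ≤ 1 → v x ≤ C)
    (hσ : 12 * Real.pi ≤ ∫ y in ball (0 : ℂ) ε, massDensity V lam v y) :
    lam ≤ C₀ * 8 ^ 6 * ε ^ 2 := by
  have h := hS.mass_annulus (r := ε) (s := 2 * ε) (c := (1 / (8 * ε)) ^ 6) hε.le (by linarith)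
    (by linarith) (by positivity) fun x hx1 hx2 => by
      have hxp : 0 < ‖x‖ := by linarith
      have h1 := hS.log_mul_mass_le hW (norm_pos_iff.1 hxp) (by linarith) hx1 hC
      have h2 : Real.log (1 / (8 * ε)) ≤ Real.log (1 / (4 * ‖x‖)) := by
        apply Real.log_le_log (by positivity)
        exact one_div_le_one_div_of_le (by positivity) (by linarith)
      have h3 : 0 ≤ Real.log (1 / (8 * ε)) := Real.log_nonneg (by
        rw [one_le_div (by positivity)]; linarith)
      have h4 : Real.log (1 / (8 * ε)) * (12 * Real.pi) ≤ 2 * Real.pi * v x :=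
        (mul_le_mul h2 hσ (by positivity) (h3.trans h2)).trans h1
      have h5 : 6 * Real.log (1 / (8 * ε)) ≤ v x := by
        have := Real.pi_pos
        nlinarith
      calc (1 / (8 * ε)) ^ 6 = Real.exp (6 * Real.log (1 / (8 * ε))) := by
            rw [show (6 : ℝ) = ((6 : ℕ) : ℝ) by norm_num, Real.exp_nat_mul,
              Real.exp_log (by positivity)]
        _ ≤ _ := Real.exp_le_exp.2 h5
  have h1 : lam * (ε ^ 2 * (1 / (8 * ε)) ^ 6 * (Real.pi * ((2 * ε) ^ 2 - ε ^ 2)))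
      = lam * (3 * Real.pi) / (8 ^ 6 * ε ^ 2) := by field_simp; ring
  rw [h1, div_le_iff₀ (by positivity)] at h
  have := hS.lam_pos
  nlinarith [Real.pi_gt_three]

end IsSol

end

section

variable {V v : ℂ → ℝ} {a b K C₀ lam : ℝ}

lemma hasFDerivAt_log_norm {x : ℂ} (hx : x ≠ 0) :
    HasFDerivAt (fun x : ℂ => Real.log ‖x‖) ((‖x‖ ^ 2)⁻¹ • innerSL ℝ x) x := by
  have h := ((hasStrictFDerivAt_norm_sq (F := ℂ) x).hasFDerivAt.log
    (pow_ne_zero 2 (norm_ne_zero_iff.2 hx))).const_mul (1 / 2)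
  have e : (fun y : ℂ => 1 / 2 * Real.log (‖y‖ ^ 2)) = fun y => Real.log ‖y‖ := by
    funext y; rw [Real.log_pow]; push_cast; ring
  rw [e] at h
  refine h.congr_fderiv ?_
  rw [smul_comm (‖x‖ ^ 2)⁻¹ (2 : ℕ), ← Nat.cast_smul_eq_nsmul ℝ, smul_smul]
  norm_num

/-- A comparison principle on an annulus, read off at the outer boundary. -/
lemma boundary_deriv_nonpos {ε s p q : ℝ} (hε : 0 < ε) (hε1 : ε < 1)
    (hc : ContinuousOn v (closedBall (0 : ℂ) 1)) (h2 : ContDiffOn ℝ 2 v (ball (0 : ℂ) 1))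
    (hbd : ∀ x ∈ sphere (0 : ℂ) 1, v x = 0) (h1 : ContDiffOn ℝ 1 v (closedBall (0 : ℂ) 1))
    (hlap : ∀ x ∈ ball (0 : ℂ) 1, ε < ‖x‖ → s * lap v x + 4 * q ≤ 0)
    (hcirc : ∀ x : ℂ, ‖x‖ = ε → 0 ≤ s * v x + p * Real.log ε + q * ε ^ 2 - q) {x : ℂ}
    (hx : x ∈ sphere (0 : ℂ) 1) :
    s * fderivWithin ℝ v (closedBall (0 : ℂ) 1) x x + p + 2 * q ≤ 0 := by
  set w : ℂ → ℝ := fun x => s * v x + p * Real.log ‖x‖ + q * ‖x‖ ^ 2 + -q with hw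
  set U : Set ℂ := ball 0 1 \ closedBall 0 ε with hUdef
  have hU : IsOpen U := isOpen_ball.sdiff isClosed_closedBall
  have hcl : closure U ⊆ closedBall 0 1 \ ball 0 ε :=
    closure_minimal (sdiff_subset_sdiff ball_subset_closedBall ball_subset_closedBall)
      (isClosed_closedBall.sdiff isOpen_ball)
  have h0 : (0 : ℂ) ∉ U := by simp [hUdef, hε.le]
  have hwb : ∀ y ∈ sphere (0 : ℂ) 1, w y = 0 := fun y hy => by
    have hn : ‖y‖ = 1 := by simpa using hy
    simp [hw, hbd y hy, hn]
  have hlapw := fun z hz =>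
    lap_add_log_add_sq hU (h2.mono sdiff_subset) h0 s p q (-q) (z := z) hz
  have hnn : ∀ y ∈ closure U, 0 ≤ w y := by
    have hcw : ContinuousOn w (closure U) := by
      have hcv := hc.mono (hcl.trans sdiff_subset)
      have hlog : ContinuousOn (fun y : ℂ => Real.log ‖y‖) (closure U) :=
        continuousOn_id.norm.log fun y hy => by
          have : ε ≤ ‖y‖ := by simpa using (hcl hy).2
          exact (hε.trans_le this).ne'
      fun_prop
    rcases U.eq_empty_or_nonempty with he | ⟨z0, hz0⟩
    · simp [he]
    refine nonneg_of_lap_nonpos hU (isBounded_ball.subset sdiff_subset) (hlapw z0 hz0).1 hcw ?_ ?_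
    · intro z hz
      rw [(hlapw z hz).2]
      exact hlap z hz.1 (by simpa using hz.2)
    · intro y hy
      rw [hU.frontier_eq] at hy
      have hy1 := hcl hy.1
      have ha : ‖y‖ ≤ 1 := by simpa using hy1.1
      have hb : ε ≤ ‖y‖ := by simpa using hy1.2
      rcases ha.eq_or_lt with ha | ha
      · exact (hwb y (by simpa using ha)).ge
      · have hy2 : ‖y‖ = ε := by
          refine le_antisymm ?_ hb
          by_contra! h
          exact hy.2 ⟨by simpa using ha, by simpa using h⟩
        have := hcirc y hy2
        simp only [hw, hy2]
        linarith
  have hxn : ‖x‖ = 1 := by simpa using hx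
  have hx0 : x ≠ 0 := norm_ne_zero_iff.1 (by rw [hxn]; norm_num)
  have hmin : IsLocalMinOn w (closedBall (0 : ℂ) 1) x := by
    have hnhds : {y : ℂ | ε < ‖y‖} ∈ nhds x :=
      (isOpen_lt continuous_const continuous_norm).mem_nhds (by simp [hxn, hε1])
    filter_upwards [self_mem_nhdsWithin, mem_nhdsWithin_of_mem_nhds hnhds] with y hy1 hy2
    rw [hwb x hx]
    have hy1' : ‖y‖ ≤ 1 := by simpa using hy1
    rcases hy1'.eq_or_lt with ha | ha
    · exact (hwb y (by simpa using ha)).ge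
    · exact hnn y (subset_closure ⟨by simpa using ha, by simpa using hy2⟩)
  have hdv := (h1.differentiableOn (by norm_num) x (sphere_subset_closedBall hx)).hasFDerivWithinAt
  have hdw := (((hdv.const_mul s).add
    ((hasFDerivAt_log_norm hx0).const_mul p).hasFDerivWithinAt).add
    ((hasStrictFDerivAt_norm_sq (F := ℂ) x).hasFDerivAt.const_mul q).hasFDerivWithinAt).add_const (-q)
  have hcone : (0 : ℂ) - x ∈ posTangentConeAt (closedBall (0 : ℂ) 1) x :=
    mem_posTangentConeAt_of_segment_subset
      ((convex_closedBall (0 : ℂ) 1).segment_subset (sphere_subset_closedBall hx) (by simp))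
  have h := hmin.hasFDerivWithinAt_nonneg hdw hcone
  simp [hxn] at h
  linarith

namespace IsSol

lemma abs_boundary_deriv_add_le (hS : IsSol V C₀ lam v)
    (h1 : ContDiffOn ℝ 1 v (closedBall (0 : ℂ) 1)) {ε C' Λ : ℝ} (hε : 0 < ε) (hε1 : ε < 1)
    (hcirc : ∀ x : ℂ, ‖x‖ = ε → |v x - 8 * Real.log (1 / ε)| ≤ C') (hΛ0 : 0 ≤ Λ)
    (hF0 : ∀ x, 0 ≤ massDensity V lam v x)
    (hΛ : ∀ x : ℂ, ε ≤ ‖x‖ → massDensity V lam v x ≤ Λ) {x : ℂ} (hx : x ∈ sphere (0 : ℂ) 1) :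
    |fderivWithin ℝ v (closedBall (0 : ℂ) 1) x x + 8| ≤ C' / Real.log (1 / ε) + Λ / 2 := by
  have hL : 0 < Real.log (1 / ε) := Real.log_pos (by rwa [one_lt_div hε])
  have hlogε : Real.log ε = -Real.log (1 / ε) := by rw [one_div, Real.log_inv, neg_neg]
  set L := Real.log (1 / ε)
  have hL1 : C' / L * L = C' := div_mul_cancel₀ _ hL.ne'
  have hlow := boundary_deriv_nonpos (s := 1) (p := 8 - C' / L) (q := 0) hε hε1 hS.cont hS.c2 hS.bd
    h1 (fun y hy _ => by rw [hS.lap_eq_neg hy]; linarith [hF0 y]) (fun y hy => by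
      have := (abs_le.1 (hcirc y hy)).1
      rw [hlogε]; linarith) hx
  have hup := boundary_deriv_nonpos (s := -1) (p := -(8 + C' / L)) (q := -(Λ / 4)) hε hε1 hS.cont
    hS.c2 hS.bd h1 (fun y hy hεy => by rw [hS.lap_eq_neg hy]; linarith [hΛ y hεy.le]) (fun y hy => by
      have := (abs_le.1 (hcirc y hy)).2
      have h4 : Λ / 4 * ε ^ 2 ≤ Λ / 4 := mul_le_of_le_one_right (by linarith)
        (pow_le_one₀ hε.le hε1.le)
      rw [hlogε]; linarith) hx
  rw [abs_le]
  constructor <;> linarith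

end IsSol

end

section

variable {V : ℂ → ℝ} {a b K C₀ : ℝ} {lam : ℕ → ℝ} {v : ℕ → ℂ → ℝ}

lemma eventually_exists_mass_near (hW : IsWeight V a b K) (hS : ∀ k, IsSol V C₀ (lam k) (v k))
    (hblow : ∀ M₀ : ℝ, ∀ᶠ k in atTop, ∃ x ∈ ball (0 : ℂ) 1, M₀ < v k x)
    (hout : ∀ εr : ℝ, 0 < εr → εr < 1 →
      ∃ Cε : ℝ, ∀ k, ∀ x : ℂ, εr ≤ ‖x‖ → ‖x‖ ≤ 1 → v k x ≤ Cε)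
    {ε κ : ℝ} (hε : 0 < ε) (hε4 : ε ≤ 1 / 4) (hκ : 0 < κ) :
    ∃ δ : ℝ, 0 < δ ∧ δ ≤ ε ∧ ∀ᶠ k in atTop, ∃ ε' : ℝ, δ ≤ ε' ∧ ε' ≤ ε ∧
      |(∫ x in ball (0 : ℂ) ε', massDensity V (lam k) (v k) x) - 16 * Real.pi| ≤ κ := by
  obtain ⟨C, hC⟩ := hout (1 / 4) (by norm_num) (by norm_num)
  obtain ⟨N, hN⟩ := exists_nat_gt (max 0
    ((2 * (2 * Real.pi * (6 + K / a) + 8 * Real.pi * C + 5 * (b * C₀)) * (2 * (b * C₀))) / κ))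
  obtain ⟨hN0, hN1⟩ := max_lt_iff.1 hN
  have hδ : 0 < ε / 2 ^ N := by positivity
  have hδε : ε / 2 ^ N ≤ ε := div_le_self hε.le (one_le_pow₀ (by norm_num))
  obtain ⟨C', hC'⟩ := hout (ε / 2 ^ N / 2) (by positivity) (by linarith)
  refine ⟨ε / 2 ^ N, hδ, hδε, ?_⟩
  filter_upwards [hblow (max C' ((2 * Real.pi * C + Real.log (1 / (ε / 2 ^ N)) * (b * C₀)
      + 4 * Real.pi * (b * C₀)) / Real.pi))] with k hk
  have hσ := (hS k).two_pi_le_mass hW hδ (hδε.trans hε4) (hC k) (hC' k) hk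
  obtain ⟨ε', h1, h2, h3⟩ := (hS k).exists_mass_near hW hε hε4 (hC k) (Nat.cast_pos.1 hN0) hσ
  refine ⟨ε', h1, h2, h3.trans ?_⟩
  rw [div_lt_iff₀ hκ] at hN1
  rw [div_le_iff₀ hN0]
  linarith

lemma tendsto_lam_zero (hW : IsWeight V a b K) (hS : ∀ k, IsSol V C₀ (lam k) (v k))
    (hblow : ∀ M₀ : ℝ, ∀ᶠ k in atTop, ∃ x ∈ ball (0 : ℂ) 1, M₀ < v k x)
    (hout : ∀ εr : ℝ, 0 < εr → εr < 1 →
      ∃ Cε : ℝ, ∀ k, ∀ x : ℂ, εr ≤ ‖x‖ → ‖x‖ ≤ 1 → v k x ≤ Cε) :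
    Tendsto lam atTop (nhds 0) := by
  obtain ⟨C, hC⟩ := hout (1 / 4) (by norm_num) (by norm_num)
  refine Metric.tendsto_atTop'.2 fun η hη => ?_
  have ht : Tendsto (fun ε : ℝ => C₀ * 8 ^ 6 * ε ^ 2) (nhdsWithin 0 (Ioi 0)) (nhds 0) := by
    have : Tendsto (fun ε : ℝ => C₀ * 8 ^ 6 * ε ^ 2) (nhds 0) (nhds (C₀ * 8 ^ 6 * 0 ^ 2)) :=
      Continuous.tendsto (by fun_prop) 0
    simpa using this.mono_left nhdsWithin_le_nhds
  obtain ⟨ε, ⟨hεη, hε0⟩, hε16⟩ := ((ht.eventually_lt_const hη).and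
    self_mem_nhdsWithin |>.and (mem_nhdsWithin_of_mem_nhds (Iic_mem_nhds
      (by norm_num : (0 : ℝ) < 1 / 16)))).exists
  have hε0 : 0 < ε := hε0
  have hε16 : ε ≤ 1 / 16 := hε16
  obtain ⟨δ, -, -, hev⟩ := eventually_exists_mass_near hW hS hblow hout hε0 (by linarith)
    (by positivity : 0 < 4 * Real.pi)
  obtain ⟨n, hn⟩ := eventually_atTop.1 hev
  refine ⟨n, fun k hk => ?_⟩
  obtain ⟨ε', -, hε', h⟩ := hn k hk.le
  have hσ : 12 * Real.pi ≤ ∫ x in ball (0 : ℂ) ε, massDensity V (lam k) (v k) x := by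
    have := (abs_le.1 h).1
    linarith [(hS k).mass_mono hW (ball_subset_ball (x := (0 : ℂ)) hε')]
  rw [Real.dist_eq, sub_zero, abs_of_pos (hS k).lam_pos]
  exact ((hS k).lam_le_sq hW hε0 hε16 (hC k) hσ).trans_lt hεη

lemma eventually_mass_near (hW : IsWeight V a b K) (hS : ∀ k, IsSol V C₀ (lam k) (v k))
    (hblow : ∀ M₀ : ℝ, ∀ᶠ k in atTop, ∃ x ∈ ball (0 : ℂ) 1, M₀ < v k x)
    (hout : ∀ εr : ℝ, 0 < εr → εr < 1 →
      ∃ Cε : ℝ, ∀ k, ∀ x : ℂ, εr ≤ ‖x‖ → ‖x‖ ≤ 1 → v k x ≤ Cε)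
    {ε κ : ℝ} (hε : 0 < ε) (hε4 : ε ≤ 1 / 4) (hκ : 0 < κ) :
    ∀ᶠ k in atTop,
      |(∫ x in ball (0 : ℂ) ε, massDensity V (lam k) (v k) x) - 16 * Real.pi| ≤ κ := by
  obtain ⟨δ, hδ0, hδ, hev⟩ := eventually_exists_mass_near hW hS hblow hout hε hε4 (half_pos hκ)
  obtain ⟨C, hC⟩ := hout δ hδ0 (by linarith)
  have ht : Tendsto (fun k => lam k * b * Real.exp C * Real.pi) atTop (nhds 0) := by
    simpa using (((tendsto_lam_zero hW hS hblow hout).mul_const b).mul_const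
      (Real.exp C)).mul_const Real.pi
  filter_upwards [hev, ht.eventually_le_const (half_pos hκ)] with k ⟨ε', h1, h2, h3⟩ hk
  set F := massDensity V (lam k) (v k) with hF
  have hFi : Integrable F := IsSol.integrable_massDensity hW (hS k)
  have hsub : ball (0 : ℂ) ε' ⊆ ball 0 ε := ball_subset_ball h2
  have hmono := (hS k).mass_mono hW hsub
  have hdiff := setIntegral_sdiff measurableSet_ball (hFi.integrableOn (s := ball (0 : ℂ) ε)) hsub
  have hsub1 : ball (0 : ℂ) ε \ ball 0 ε' ⊆ ball 0 1 :=
    sdiff_subset.trans (ball_subset_ball (by linarith))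
  have hle : ∫ x in ball (0 : ℂ) ε \ ball 0 ε', F x ≤ lam k * b * Real.exp C * Real.pi := by
    have hfin := (measure_mono hsub1).trans_lt (measure_ball_lt_top (μ := volume) (x := (0 : ℂ)))
    calc _ ≤ ∫ x in ball (0 : ℂ) ε \ ball 0 ε', lam k * b * Real.exp C := by
          refine setIntegral_mono_on hFi.integrableOn (integrableOn_const hfin.ne)
            (measurableSet_ball.diff measurableSet_ball) fun x hx => ?_
          refine IsSol.massDensity_le hW (hS k) fun hx1 => hC k x ?_ ?_
          · have : ε' ≤ ‖x‖ := by simpa using hx.2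
            linarith
          · exact (mem_ball_zero_iff.1 hx1).le
      _ ≤ ∫ x in ball (0 : ℂ) 1, lam k * b * Real.exp C := by
          have h0 : 0 ≤ lam k * b * Real.exp C := by
            have := (hS k).lam_pos
            have := hW.upper_pos
            positivity
          exact setIntegral_mono_set (integrableOn_const measure_ball_lt_top.ne)
            (Eventually.of_forall fun _ => h0) (Eventually.of_forall hsub1)
      _ = _ := by
          rw [setIntegral_const, measureReal_def, Complex.volume_ball]
          simp [mul_comm]
  rw [abs_le] at h3 ⊢
  constructor <;> linarith

end

/-- The outward normal derivative of `v_k` on the unit circle converges uniformly to `-8`. -/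
theorem normal_derivative_limit
    (lam : ℕ → ℝ) (hlam : ∀ k, 0 < lam k)
    (v : ℕ → ℂ → ℝ) (V : ℂ → ℝ)
    (hvc : ∀ k, ContinuousOn (v k) (closedBall (0 : ℂ) 1))
    (hv2 : ∀ k, ContDiffOn ℝ 2 (v k) (ball (0 : ℂ) 1))
    (hPDE : ∀ k, ∀ x ∈ ball (0 : ℂ) 1,
      -lap (v k) x = lam k * ‖x‖ ^ 2 * V x * Real.exp (v k x))
    (hbd : ∀ k, ∀ x ∈ sphere (0 : ℂ) 1, v k x = 0)
    (C₀ : ℝ)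
    (hmass : ∀ k, lam k * ∫ x in ball (0 : ℂ) 1, ‖x‖ ^ 2 * Real.exp (v k x) ≤ C₀)
    (hblow : ∀ M₀ : ℝ, ∀ᶠ k in atTop, ∃ x ∈ ball (0 : ℂ) 1, M₀ < v k x)
    (hout : ∀ εr : ℝ, 0 < εr → εr < 1 →
      ∃ Cε : ℝ, ∀ k, ∀ x : ℂ, εr ≤ ‖x‖ → ‖x‖ ≤ 1 → v k x ≤ Cε)
    (hV1 : ContDiffOn ℝ 1 V (closedBall (0 : ℂ) 1))
    (hV2 : ∃ r : ℝ, 0 < r ∧ ContDiffOn ℝ 2 V (ball (0 : ℂ) r))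
    (hVpos : ∀ x ∈ closedBall (0 : ℂ) 1, 0 < V x)
    (hV0 : grad V 0 = 0)
    (hv1 : ∀ k, ContDiffOn ℝ 1 (v k) (closedBall (0 : ℂ) 1)) :
    ∀ η : ℝ, 0 < η → ∀ᶠ k in atTop, ∀ x ∈ sphere (0 : ℂ) 1,
      |fderivWithin ℝ (v k) (closedBall (0 : ℂ) 1) x x + 8| < η := by
  have hcpt := isCompact_closedBall (0 : ℂ) 1
  have hne : (closedBall (0 : ℂ) 1).Nonempty := nonempty_closedBall.2 zero_le_one
  obtain ⟨xa, hxa, hmin⟩ := hcpt.exists_isMinOn hne hV1.continuousOn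
  obtain ⟨xb, hxb, hmax⟩ := hcpt.exists_isMaxOn hne hV1.continuousOn
  have hVball : ContDiffOn ℝ 1 V (ball (0 : ℂ) 1) := hV1.mono ball_subset_closedBall
  obtain ⟨K, hK⟩ := (isCompact_closedBall (0 : ℂ) (1 / 2)).exists_bound_of_continuousOn
    ((hVball.continuousOn_fderiv_of_isOpen isOpen_ball le_rfl).mono
      (closedBall_subset_ball (by norm_num)))
  have hW : IsWeight V (V xa) (V xb) K :=
    ⟨hVpos xa hxa, fun x hx => hmin hx, fun x hx => hmax hx, hV1.continuousOn, hVball, hK⟩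
  have hS : ∀ k, IsSol V C₀ (lam k) (v k) := fun k =>
    ⟨hlam k, hvc k, hv2 k, hPDE k, hbd k, hmass k⟩
  intro η hη
  obtain ⟨C, hC⟩ := hout (1 / 4) (by norm_num) (by norm_num)
  have hC0 : 0 ≤ C := ((hS 0).nonneg hW 1 (by simp)).trans (hC 0 1 (by norm_num) (by simp))
  set T := 2 * (C + 16) / η + 7 with hT
  have hT7 : 7 ≤ T := by
    have : 0 ≤ 2 * (C + 16) / η := by positivity
    linarith
  set ε := Real.exp (-T) with hεdef
  have hε : 0 < ε := Real.exp_pos _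
  have hε8 : ε ≤ 1 / 8 := by
    rw [hεdef, Real.exp_neg, inv_le_comm₀ (Real.exp_pos _) (by norm_num)]
    linarith [Real.add_one_le_exp T]
  have hlog : Real.log (1 / ε) = T := by rw [one_div, Real.log_inv, hεdef, Real.log_exp, neg_neg]
  have hCT : (C + 16) / T < η / 2 := by
    rw [div_lt_iff₀ (by linarith), hT]
    have : η / 2 * (2 * (C + 16) / η + 7) = C + 16 + 7 / 2 * η := by field_simp
    linarith
  obtain ⟨C', hC'⟩ := hout (ε / 2) (by positivity) (by linarith)
  have ht : Tendsto (fun k => lam k * V xb * Real.exp C') atTop (nhds 0) := by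
    simpa using ((tendsto_lam_zero hW hS hblow hout).mul_const (V xb)).mul_const (Real.exp C')
  have hpi := Real.pi_pos
  filter_upwards [ht.eventually_le_const (lt_min one_pos hη), eventually_mass_near hW hS hblow hout
    hε (by linarith) (by positivity : 0 < 2 * Real.pi / T)] with k hΛ hσ x hx
  have hF0 := IsSol.massDensity_nonneg hW (hS k)
  have hΛ0 : 0 ≤ lam k * V xb * Real.exp C' := by
    have := hlam k
    have := hW.upper_pos
    positivity
  have hcirc : ∀ y : ℂ, ‖y‖ = ε → |v k y - 8 * Real.log (1 / ε)| ≤ C + 16 := by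
    intro y hy
    have hy0 : y ≠ 0 := norm_pos_iff.1 (hy ▸ hε)
    have hlow := (hS k).log_mul_mass_le hW hy0 (hy ▸ hε8) hy.ge (hC k)
    have hup := (hS k).le_log_mul_mass hW hy0 (by linarith) (hC k) (C' := C') (by rw [hy]; exact hC' k)
    have hlog4 : Real.log (1 / (4 * ‖y‖)) = T - Real.log 4 := by
      rw [hy, one_div, Real.log_inv, Real.log_mul (by norm_num) hε.ne', hεdef, Real.log_exp]
      ring
    have h4 : Real.log 4 ≤ 7 / 5 := by
      rw [show (4 : ℝ) = 2 ^ 2 by norm_num, Real.log_pow]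
      push_cast
      linarith [Real.log_two_lt_d9]
    have h40 : 0 ≤ Real.log 4 := Real.log_nonneg (by norm_num)
    rw [hlog4] at hlow
    rw [hy, hlog] at hup
    rw [hlog]
    set σ := ∫ x in ball (0 : ℂ) ε, massDensity V (lam k) (v k) x
    have hκT : 2 * Real.pi / T * T = 2 * Real.pi := div_mul_cancel₀ _ (by linarith)
    obtain ⟨hσ1, hσ2⟩ := abs_le.1 hσ
    have hκ0 : 0 < 2 * Real.pi / T := by positivity
    have hΛ1 := hΛ.trans (min_le_left _ _)
    have u1 : T * σ ≤ T * (16 * Real.pi + 2 * Real.pi / T) := by gcongr; linarith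
    have u2 : (T - Real.log 4) * (16 * Real.pi - 2 * Real.pi / T) ≤ (T - Real.log 4) * σ := by
      gcongr <;> linarith
    have u3 : Real.log 4 * Real.pi ≤ 7 / 5 * Real.pi := by gcongr
    have u4 : 0 ≤ Real.log 4 * (2 * Real.pi / T) := by positivity
    have u5 : lam k * V xb * Real.exp C' * (Real.pi / 2) ≤ 1 * (Real.pi / 2) := by gcongr
    rw [abs_le]
    constructor
    · refine le_of_mul_le_mul_left ?_ (by positivity : 0 < 2 * Real.pi)
      nlinarith [mul_nonneg hC0 hpi.le]
    · refine le_of_mul_le_mul_left ?_ (by positivity : 0 < 2 * Real.pi)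
      nlinarith [mul_nonneg hC0 hpi.le]
  have h := (hS k).abs_boundary_deriv_add_le (hv1 k) hε (by linarith) hcirc hΛ0 hF0
    (fun y hy => IsSol.massDensity_le hW (hS k) fun hy1 =>
      hC' k y (by linarith) (mem_ball_zero_iff.1 hy1).le) hx
  rw [hlog] at h
  linarith [hΛ.trans (min_le_right _ _)]
end
end

section
/- For every μ ∈ ℝ, λ > 0, p ∈ ℂ and every nonnegative integer N, the function V(y) = log( e^μ / (1 + (e^μ/λ) |y^{N+1} − p|²)² ) is smooth on ℝ² and satisfies ΔV(y) + (8(N+1)²/λ) |y|^{2N} e^{V(y)} = 0 for every y ∈ ℝ², and moreover ∫_{ℝ²} |y|^{2N} e^{V(y)} dy < ∞. -/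
open MeasureTheory Filter Metric Set

noncomputable section

open scoped RealInnerProductSpace in
/-- First directional derivative of `a - 2 log (1 + c ‖F‖²)` for holomorphic `F`. -/
theorem dderiv_const_sub_log_one_add_norm_sq {a c : ℝ} (hc : 0 < c) {F F' : ℂ → ℂ}
    (hF : ∀ z, HasDerivAt F (F' z) z) (v : ℂ) :
    dderiv v (fun z => a - 2 * Real.log (1 + c * ‖F z‖ ^ 2)) =
      fun z => -(4 * c) * (⟪F z, F' z * v⟫ / (1 + c * ‖F z‖ ^ 2)) := by
  funext z
  have hD : 1 + c * ‖F z‖ ^ 2 ≠ 0 := by positivity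
  have hFz := (hF z).hasFDerivAt.restrictScalars ℝ
  have h := (((hFz.norm_sq.const_mul c).const_add 1).log hD).const_mul 2 |>.const_sub a
  rw [dderiv, h.fderiv]
  simp [mul_comm v]
  field_simp
  ring

open scoped RealInnerProductSpace in
/-- Second directional derivative of `a - 2 log (1 + c ‖F‖²)` for holomorphic `F`. -/
theorem dderiv_dderiv_const_sub_log_one_add_norm_sq {a c : ℝ} (hc : 0 < c) {F F' F'' : ℂ → ℂ}
    (hF : ∀ z, HasDerivAt F (F' z) z) (hF' : ∀ z, HasDerivAt F' (F'' z) z) (v z : ℂ) :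
    dderiv v (dderiv v (fun z => a - 2 * Real.log (1 + c * ‖F z‖ ^ 2))) z =
      -(4 * c) * (((⟪F z, F'' z * v * v⟫ + ⟪F' z * v, F' z * v⟫) * (1 + c * ‖F z‖ ^ 2)
        - 2 * c * ⟪F z, F' z * v⟫ ^ 2) / (1 + c * ‖F z‖ ^ 2) ^ 2) := by
  have hD : 1 + c * ‖F z‖ ^ 2 ≠ 0 := by positivity
  have hFz := (hF z).hasFDerivAt.restrictScalars ℝ
  have hFz' := ((hF' z).mul_const v).hasFDerivAt.restrictScalars ℝ
  have hinv := (hasDerivAt_inv hD).comp_hasFDerivAt z ((hFz.norm_sq.const_mul c).const_add 1)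
  have h := ((hFz.inner ℝ hFz').mul hinv).const_mul (-(4 * c))
  rw [dderiv_const_sub_log_one_add_norm_sq hc hF, dderiv]
  simp only [div_eq_mul_inv]
  refine (congrArg (fun L : ℂ →L[ℝ] ℝ => L v) h.fderiv).trans ?_
  simp [fderivInnerCLM_apply, mul_comm v]
  field_simp
  ring

/-- Liouville's formula: the Laplacian of `a - 2 log (1 + c ‖F‖²)` for holomorphic `F`. -/
theorem lap_const_sub_log_one_add_norm_sq {a c : ℝ} (hc : 0 < c) {F F' F'' : ℂ → ℂ}
    (hF : ∀ z, HasDerivAt F (F' z) z) (hF' : ∀ z, HasDerivAt F' (F'' z) z) (z : ℂ) :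
    lap (fun z => a - 2 * Real.log (1 + c * ‖F z‖ ^ 2)) z =
      -(8 * c * ‖F' z‖ ^ 2 / (1 + c * ‖F z‖ ^ 2) ^ 2) := by
  simp only [lap, pd, Function.iterate_succ, Function.iterate_zero, Function.comp_apply, id_eq]
  rw [dderiv_dderiv_const_sub_log_one_add_norm_sq hc hF hF',
    dderiv_dderiv_const_sub_log_one_add_norm_sq hc hF hF', ← mul_add, ← add_div,
    ← mul_div_assoc, ← neg_div]
  congr 1
  simp only [Complex.inner, Complex.sq_norm, Complex.normSq_apply, Complex.mul_re,
    Complex.mul_im, Complex.conj_re, Complex.conj_im, Complex.I_re, Complex.I_im,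
    Complex.one_re, Complex.one_im]
  ring

/-- Growth comparison behind the finiteness of the mass. -/
theorem norm_pow_mul_one_add_norm_sq_le {c : ℝ} (hc : 0 < c) (p y : ℂ) (N : ℕ) :
    ‖y‖ ^ N * (1 + ‖y‖ ^ 2) ≤
      (2 * (1 + 2 * ‖p‖ ^ 2) + 4 / c) * (1 + c * ‖y ^ (N + 1) - p‖ ^ 2) := by
  have key : ∀ k ≤ 2 * (N + 1), ‖y‖ ^ k ≤ 1 + (‖y‖ ^ (N + 1)) ^ 2 := by
    intro k hk
    rw [← pow_mul, mul_comm (N + 1)]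
    rcases le_total ‖y‖ 1 with h | h
    · have := pow_le_one₀ (n := k) (norm_nonneg y) h
      have : 0 ≤ ‖y‖ ^ (2 * (N + 1)) := by positivity
      linarith
    · have := pow_le_pow_right₀ h hk
      linarith
  have h1 := key N (by omega)
  have h2 := key (N + 2) (by omega)
  have h3 : ‖y‖ ^ (N + 1) ≤ ‖y ^ (N + 1) - p‖ + ‖p‖ := by
    rw [← norm_pow]
    simpa using norm_add_le (y ^ (N + 1) - p) p
  have h4 : (‖y‖ ^ (N + 1)) ^ 2 ≤ 2 * ‖y ^ (N + 1) - p‖ ^ 2 + 2 * ‖p‖ ^ 2 := by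
    have := pow_le_pow_left₀ (by positivity) h3 2
    nlinarith [sq_nonneg (‖y ^ (N + 1) - p‖ - ‖p‖)]
  have h5 : (2 * (1 + 2 * ‖p‖ ^ 2) + 4 / c) * (1 + c * ‖y ^ (N + 1) - p‖ ^ 2) =
      2 * (1 + 2 * ‖p‖ ^ 2) + 4 * ‖y ^ (N + 1) - p‖ ^ 2
        + (4 / c + 2 * (1 + 2 * ‖p‖ ^ 2) * (c * ‖y ^ (N + 1) - p‖ ^ 2)) := by
    field_simp
    ring
  have h6 : 0 ≤ 4 / c + 2 * (1 + 2 * ‖p‖ ^ 2) * (c * ‖y ^ (N + 1) - p‖ ^ 2) := by positivity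
  rw [h5, mul_add, mul_one, ← pow_add]
  linarith

/-- The explicit global Liouville profiles: smoothness, equation and finite mass. -/
theorem global_liouville_solution
    (μ lam : ℝ) (hlam : 0 < lam) (p : ℂ) (N : ℕ)
    (V : ℂ → ℝ)
    (hV : ∀ y : ℂ, V y = Real.log (Real.exp μ /
      (1 + Real.exp μ / lam * ‖y ^ (N + 1) - p‖ ^ 2) ^ 2)) :
    (∀ n : ℕ, ContDiff ℝ n V) ∧
    (∀ y : ℂ, lap V y + 8 * (N + 1) ^ 2 / lam * ‖y‖ ^ (2 * N) * Real.exp (V y) = 0) ∧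
    Integrable (fun y : ℂ => ‖y‖ ^ (2 * N) * Real.exp (V y)) := by
  have hc : 0 < Real.exp μ / lam := by positivity
  set c := Real.exp μ / lam with hcdef
  have hD : ∀ y : ℂ, 0 < 1 + c * ‖y ^ (N + 1) - p‖ ^ 2 := fun y => by positivity
  have hV' : V = fun y => μ - 2 * Real.log (1 + c * ‖y ^ (N + 1) - p‖ ^ 2) := by
    funext y
    rw [hV, Real.log_div (Real.exp_ne_zero _) (pow_ne_zero 2 (hD y).ne'), Real.log_exp,
      Real.log_pow]
    norm_num
  have hexp : ∀ y, Real.exp (V y) = Real.exp μ / (1 + c * ‖y ^ (N + 1) - p‖ ^ 2) ^ 2 := by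
    intro y
    have := hD y
    rw [hV, Real.exp_log (by positivity)]
  have hsmooth : ∀ n : ℕ, ContDiff ℝ n V := by
    intro n
    rw [hV']
    have hF : ContDiff ℝ n fun y : ℂ => y ^ (N + 1) - p := by fun_prop
    exact contDiff_const.sub (contDiff_const.mul
      ((contDiff_const.add (contDiff_const.mul (hF.norm_sq ℝ))).log fun y => (hD y).ne'))
  refine ⟨hsmooth, fun y => ?_, ?_⟩
  · have hF : ∀ z : ℂ, HasDerivAt (fun z : ℂ => z ^ (N + 1) - p) ((N + 1) * z ^ N) z := by
      intro z
      simpa using (hasDerivAt_pow (N + 1) z).sub_const p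
    have hF' : ∀ z : ℂ, HasDerivAt (fun z : ℂ => (N + 1) * z ^ N)
        ((N + 1) * (N * z ^ (N - 1))) z :=
      fun z => (hasDerivAt_pow N z).const_mul _
    have hnorm : ‖(N + 1 : ℂ)‖ = N + 1 := by
      exact_mod_cast Complex.norm_natCast (N + 1)
    rw [hexp, hV', lap_const_sub_log_one_add_norm_sq hc hF hF', norm_mul, hnorm, norm_pow,
      mul_pow, ← pow_mul, mul_comm N 2, hcdef]
    ring
  · have hint : Integrable fun y : ℂ => ((1 : ℝ) + ‖y‖ ^ 2) ^ (-(4 : ℝ) / 2) :=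
      integrable_rpow_neg_one_add_norm_sq (by simp [Complex.finrank_real_complex]; norm_num)
    set K := 2 * (1 + 2 * ‖p‖ ^ 2) + 4 / c
    refine (hint.const_mul (Real.exp μ * K ^ 2)).mono' ?_ (ae_of_all _ fun y => ?_)
    · have := (hsmooth 0).continuous
      exact Continuous.aestronglyMeasurable (by fun_prop)
    · have hle := pow_le_pow_left₀ (by positivity) (norm_pow_mul_one_add_norm_sq_le hc p y N) 2
      have hDy := hD y
      have hy : (0 : ℝ) < 1 + ‖y‖ ^ 2 := by positivity
      rw [hexp, Real.norm_of_nonneg (by positivity), show (-(4 : ℝ) / 2) = -(2 : ℕ) by norm_num,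
        Real.rpow_neg hy.le, Real.rpow_natCast, ← div_eq_mul_inv, ← mul_div_assoc,
        div_le_div_iff₀ (by positivity) (by positivity)]
      calc ‖y‖ ^ (2 * N) * Real.exp μ * (1 + ‖y‖ ^ 2) ^ 2
          = Real.exp μ * (‖y‖ ^ N * (1 + ‖y‖ ^ 2)) ^ 2 := by ring
        _ ≤ Real.exp μ * (K * (1 + c * ‖y ^ (N + 1) - p‖ ^ 2)) ^ 2 := by gcongr
        _ = Real.exp μ * K ^ 2 * (1 + c * ‖y ^ (N + 1) - p‖ ^ 2) ^ 2 := by ring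
end
end
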